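/- arXiv:math/0510527 — 11 statements merged into one kernel-verified Lean document; each statement's English description precedes it below -/
import Mathlib

section
/- Let γ' > γ > 0, C > 0 and set β = 1/γ. Let (t_n)_{n≥0} be a sequence of positive reals with t_n → 0, and suppose there is a constant C₂ ≥ 0 such that t_{n-1} ≥ t_n + C·t_n^{1+γ} − C₂·t_n^{1+γ'} for all n ≥ 1. Then there exist β' > β, an integer k ≥ 0, a constant C₃ > 0 and N ≥ 1 such that t_n ≤ (γC(n+k))^{-β} + C₃·(n+k)^{-β'} for all n ≥ N. -/
open Filter Topology

/-- One step of the recursion, in the variable `x ^ (-γ)`. -/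
theorem rpow_neg_add_le_rpow_neg {γ γ' C C₂ δ x y : ℝ} (hγ : 0 < γ) (hC : 0 < C) (hC₂ : 0 ≤ C₂)
    (hδγ : δ ≤ γ) (hδγ' : δ ≤ γ' - γ) (hx : 0 < x) (hx1 : x ≤ 1) (hsmall : C₂ * x ^ δ ≤ C)
    (hxy : x + C * x ^ (1 + γ) - C₂ * x ^ (1 + γ') ≤ y) :
    y ^ (-γ) + γ * C - γ * (C₂ + C * ((1 + γ) * C)) * x ^ δ ≤ x ^ (-γ) := by
  set p := x ^ γ with hp
  set q := x ^ (γ' - γ) with hq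
  set d := x ^ δ with hd
  have hp0 : 0 < p := Real.rpow_pos_of_pos hx _
  have hq0 : 0 < q := Real.rpow_pos_of_pos hx _
  have hd0 : 0 < d := Real.rpow_pos_of_pos hx _
  have hpd : p ≤ d := Real.rpow_le_rpow_of_exponent_ge hx hx1 hδγ
  have hqd : q ≤ d := Real.rpow_le_rpow_of_exponent_ge hx hx1 hδγ'
  have hq2 : C₂ * q ≤ C₂ * d := mul_le_mul_of_nonneg_left hqd hC₂
  set g := C - C₂ * q with hg
  have hg0 : 0 ≤ g := by linarith
  have hgC : g ≤ C := by
    have := mul_nonneg hC₂ hq0.le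
    linarith
  set h := p * g with hh
  have hh0 : 0 ≤ h := mul_nonneg hp0.le hg0
  have hhd : h ≤ C * d := by
    calc p * g ≤ d * C := mul_le_mul hpd hgC hg0 hd0.le
      _ = C * d := mul_comm _ _
  have e1 : x ^ (1 + γ) = x * p := by rw [Real.rpow_add hx, Real.rpow_one]
  have e2 : x ^ (1 + γ') = x * (p * q) := by
    rw [hp, hq, ← Real.rpow_add hx, Real.rpow_add hx, Real.rpow_one]
    ring_nf
  have hy : x * (1 + h) ≤ y := by
    rw [e1, e2] at hxy
    calc x * (1 + h) = x + C * (x * p) - C₂ * (x * (p * q)) := by rw [hh, hg]; ring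
      _ ≤ y := hxy
  have h1 : 0 < 1 + h := by linarith
  have hD : 0 < 1 + h + γ * h := by have := mul_nonneg hγ.le hh0; linarith
  have hu : x ^ (-γ) = p⁻¹ := Real.rpow_neg hx.le _
  have hyu : y ^ (-γ) ≤ p⁻¹ * (1 + h) ^ (-γ) := by
    rw [← hu, ← Real.mul_rpow hx.le h1.le]
    exact Real.rpow_le_rpow_of_nonpos (mul_pos hx h1) hy (by linarith)
  have hlog : h / (1 + h) ≤ Real.log (1 + h) := by
    have := Real.one_sub_inv_le_log_of_pos h1
    have e : h / (1 + h) = 1 - (1 + h)⁻¹ := by field_simp; ring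
    linarith
  have hpow : 1 + γ * h / (1 + h) ≤ (1 + h) ^ γ := by
    rw [Real.rpow_def_of_pos h1]
    have := Real.add_one_le_exp (Real.log (1 + h) * γ)
    have h2 := mul_le_mul_of_nonneg_left hlog hγ.le
    rw [← mul_div_assoc] at h2
    linarith
  have hinv : (1 + h) ^ (-γ) ≤ 1 - γ * h / (1 + h + γ * h) := by
    rw [Real.rpow_neg h1.le]
    have h3 : 0 < 1 + γ * h / (1 + h) := by positivity
    calc ((1 + h) ^ γ)⁻¹ ≤ (1 + γ * h / (1 + h))⁻¹ := inv_anti₀ h3 hpow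
      _ = 1 - γ * h / (1 + h + γ * h) := by
        have : 1 + γ * h / (1 + h) = (1 + h + γ * h) / (1 + h) := by field_simp
        rw [this, inv_div]
        field_simp
        ring
  have hmain : p⁻¹ * (1 + h) ^ (-γ) ≤ p⁻¹ - γ * g / (1 + h + γ * h) := by
    have := mul_le_mul_of_nonneg_left hinv (inv_pos.2 hp0).le
    have e : p⁻¹ * (1 - γ * h / (1 + h + γ * h)) = p⁻¹ - γ * g / (1 + h + γ * h) := by
      rw [mul_sub, mul_one, ← mul_div_assoc]
      congr 2
      rw [hh]
      field_simp
    linarith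
  have hfrac : γ * g * (1 - (1 + γ) * h) ≤ γ * g / (1 + h + γ * h) := by
    rw [le_div_iff₀ hD]
    have h5 : 0 ≤ γ * g * ((1 + γ) * h) ^ 2 := by positivity
    nlinarith
  have hlast : γ * C - γ * (C₂ + C * ((1 + γ) * C)) * d ≤ γ * g * (1 - (1 + γ) * h) := by
    have h6 : g * ((1 + γ) * h) ≤ C * ((1 + γ) * (C * d)) := by gcongr
    have h7 : C - (C₂ + C * ((1 + γ) * C)) * d ≤ g * (1 - (1 + γ) * h) := by
      rw [mul_sub, mul_one]
      linarith
    have := mul_le_mul_of_nonneg_left h7 hγ.le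
    linarith
  rw [hu]
  linarith

/-- Concavity bound for the increments of `s ↦ s ^ (1 - ρ)`. -/
theorem rpow_one_sub_add_le {ρ s : ℝ} (hρ : 0 < ρ) (hρ1 : ρ < 1) (hs : 0 ≤ s) :
    s ^ (1 - ρ) + (1 - ρ) * (s + 1) ^ (-ρ) ≤ (s + 1) ^ (1 - ρ) := by
  have h1 : 0 < s + 1 := by linarith
  have hle : (1 + -(s + 1)⁻¹) ^ (1 - ρ) ≤ 1 + (1 - ρ) * -(s + 1)⁻¹ := by
    refine rpow_one_add_le_one_add_mul_self ?_ (by linarith) (by linarith)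
    have : (s + 1)⁻¹ ≤ 1 := inv_le_one_of_one_le₀ (by linarith)
    linarith
  have e : s = (s + 1) * (1 + -(s + 1)⁻¹) := by field_simp; ring
  have h0 : 0 ≤ 1 + -(s + 1)⁻¹ := by
    have : (s + 1)⁻¹ ≤ 1 := inv_le_one_of_one_le₀ (by linarith)
    linarith
  have e2 : s ^ (1 - ρ) = (s + 1) ^ (1 - ρ) * (1 + -(s + 1)⁻¹) ^ (1 - ρ) := by
    rw [← Real.mul_rpow h1.le h0, ← e]
  have e3 : (s + 1) ^ (-ρ) = (s + 1) ^ (1 - ρ) * (s + 1)⁻¹ := by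
    rw [← Real.rpow_neg_one (s + 1), ← Real.rpow_add h1]
    ring_nf
  have := mul_le_mul_of_nonneg_left hle (Real.rpow_pos_of_pos h1 (1 - ρ)).le
  rw [e2, e3]
  linarith

/-- A sequence tending to infinity with increments at least `a - M u ^ (-ρ)` grows at least like
`a n - A n ^ (1 - ρ)`. -/
theorem exists_linear_sub_rpow_le {u : ℕ → ℝ} {a M ρ : ℝ} (ha : 0 < a) (hM : 0 ≤ M) (hρ : 0 < ρ)
    (hρ1 : ρ < 1) (hpos : ∀ n, 0 < u n) (hu : Tendsto u atTop atTop)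
    (hrec : ∀ᶠ n in atTop, u n + a - M * u (n + 1) ^ (-ρ) ≤ u (n + 1)) :
    ∃ A : ℝ, 0 < A ∧ ∀ᶠ n : ℕ in atTop, a * n - A * (n : ℝ) ^ (1 - ρ) ≤ u n := by
  have hlim : Tendsto (fun n => M * u (n + 1) ^ (-ρ)) atTop (𝓝 0) := by
    have := ((tendsto_rpow_neg_atTop hρ).comp (hu.comp (tendsto_add_atTop_nat 1))).const_mul M
    simpa using this
  obtain ⟨N, hN⟩ := eventually_atTop.1 (hrec.and (hlim.eventually_le_const (half_pos ha)))
  have hlin : ∀ n, N ≤ n → a / 2 * ((n : ℝ) - N) ≤ u n := by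
    intro n hn
    induction n, hn using Nat.le_induction with
    | base => simpa using (hpos N).le
    | succ n hn ih =>
      obtain ⟨h1, h2⟩ := hN n hn
      push_cast
      linarith
  have hlin' : ∀ n, 2 * N ≤ n → a / 4 * (n : ℝ) ≤ u n := by
    intro n hn
    have h1 := hlin n (by omega)
    have h2 : 2 * (N : ℝ) ≤ n := by exact_mod_cast hn
    have h3 := mul_le_mul_of_nonneg_left h2 ha.le
    linarith
  set M' := M * (a / 4) ^ (-ρ) with hM'
  have hM'0 : 0 ≤ M' := by positivity
  set N' := 2 * N + 1 with hN'
  set A := M' / (1 - ρ) + a * N' with hA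
  have hρ' : 0 < 1 - ρ := by linarith
  have hN'1 : (1 : ℝ) ≤ N' := by rw [hN']; push_cast; linarith [(Nat.cast_nonneg N : (0 : ℝ) ≤ N)]
  have hAM : M' ≤ A * (1 - ρ) := by
    rw [hA, add_mul, div_mul_cancel₀ _ hρ'.ne']
    have : 0 ≤ a * N' * (1 - ρ) := by positivity
    linarith
  refine ⟨A, by positivity, eventually_atTop.2 ⟨N', fun n hn => ?_⟩⟩
  induction n, hn using Nat.le_induction with
  | base =>
    have h1 : (1 : ℝ) ≤ (N' : ℝ) ^ (1 - ρ) := Real.one_le_rpow hN'1 hρ'.le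
    have h2 : A * 1 ≤ A * (N' : ℝ) ^ (1 - ρ) := mul_le_mul_of_nonneg_left h1 (by positivity)
    have h3 : a * N' ≤ A := by rw [hA]; linarith [div_nonneg hM'0 hρ'.le]
    linarith [hpos N']
  | succ n hn ih =>
    have h1 := (hN n (by omega)).1
    have h2 := hlin' (n + 1) (by omega)
    have hn0 : (0 : ℝ) < (n : ℝ) + 1 := by positivity
    push_cast at h2 ⊢
    have h3 : u (n + 1) ^ (-ρ) ≤ (a / 4) ^ (-ρ) * ((n : ℝ) + 1) ^ (-ρ) := by
      rw [← Real.mul_rpow (by positivity) hn0.le]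
      exact Real.rpow_le_rpow_of_nonpos (by positivity) h2 (by linarith)
    have h4 : M * u (n + 1) ^ (-ρ) ≤ M' * ((n : ℝ) + 1) ^ (-ρ) := by
      rw [hM', mul_assoc]
      exact mul_le_mul_of_nonneg_left h3 hM
    have h5 := rpow_one_sub_add_le hρ hρ1 (Nat.cast_nonneg (α := ℝ) n)
    have h6 := mul_le_mul_of_nonneg_left h5 (show 0 ≤ A by positivity)
    have h7 := mul_le_mul_of_nonneg_right hAM (Real.rpow_pos_of_pos hn0 (-ρ)).le
    linarith

theorem one_sub_rpow_neg_le {b y : ℝ} (hb : 0 ≤ b) (hy : 0 ≤ y) (hy2 : y ≤ 1 / 2) :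
    (1 - y) ^ (-b) ≤ 1 + 2 * b * Real.exp b * y := by
  have h1 : 0 < 1 - y := by linarith
  have hlog : -(2 * y) ≤ Real.log (1 - y) := by
    have := Real.one_sub_inv_le_log_of_pos h1
    have h2 : (1 - y)⁻¹ ≤ 1 + 2 * y := by
      rw [inv_le_iff_one_le_mul₀ h1]
      nlinarith
    linarith
  have hw : 0 ≤ 2 * b * y := by positivity
  have hwb : 2 * b * y ≤ b := by nlinarith
  have hexp : Real.exp (2 * b * y) ≤ 1 + 2 * b * y * Real.exp (2 * b * y) := by
    have h3 := Real.add_one_le_exp (-(2 * b * y))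
    have h4 := mul_le_mul_of_nonneg_right h3 (Real.exp_pos (2 * b * y)).le
    rw [← Real.exp_add, neg_add_cancel, Real.exp_zero] at h4
    linarith
  have h5 := mul_le_mul_of_nonneg_left (Real.exp_le_exp.2 hwb) hw
  calc (1 - y) ^ (-b) = Real.exp (Real.log (1 - y) * -b) := Real.rpow_def_of_pos h1 _
    _ ≤ Real.exp (2 * b * y) := Real.exp_le_exp.2 (by nlinarith)
    _ ≤ 1 + 2 * b * Real.exp b * y := by linarith


/-- Lemma 3.1 of Hu–Vaienti (upper-bound direction): if a positive sequence
`t n → 0` satisfies `t (n-1) ≥ t n + C t n ^ (1+γ) − C₂ t n ^ (1+γ')`, then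
`t n ≤ (γ C (n+k))^{-1/γ} + C₃ (n+k)^{-β'}` eventually, with `β' > 1/γ`. -/
theorem stmt_0 (γ γ' C C₂ : ℝ) (hγ : 0 < γ) (hγγ' : γ < γ') (hC : 0 < C) (hC₂ : 0 ≤ C₂)
    (t : ℕ → ℝ) (hpos : ∀ n, 0 < t n)
    (hlim : Filter.Tendsto t Filter.atTop (nhds 0))
    (hrec : ∀ n : ℕ,
      t (n + 1) + C * t (n + 1) ^ (1 + γ) - C₂ * t (n + 1) ^ (1 + γ') ≤ t n) :
    ∃ β' : ℝ, 1 / γ < β' ∧ ∃ k : ℕ, ∃ C₃ : ℝ, 0 < C₃ ∧ ∃ N : ℕ, 1 ≤ N ∧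
      ∀ n : ℕ, N ≤ n →
        t n ≤ (γ * C * ((n : ℝ) + k)) ^ (-(1 / γ)) + C₃ * ((n : ℝ) + k) ^ (-β') := by
  obtain ⟨δ, hδ, hδγ, hδγ'⟩ : ∃ δ : ℝ, 0 < δ ∧ δ < γ ∧ δ ≤ γ' - γ := by
    refine ⟨min (γ / 2) (γ' - γ), lt_min (by linarith) (by linarith), ?_, min_le_right _ _⟩
    exact (min_le_left _ _).trans_lt (by linarith)
  set a := γ * C with ha_def
  have ha : 0 < a := mul_pos hγ hC
  have hρ : 0 < δ / γ := div_pos hδ hγ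
  have hρ1 : δ / γ < 1 := (div_lt_one hγ).2 hδγ
  have hupos : ∀ n, 0 < t n ^ (-γ) := fun n => Real.rpow_pos_of_pos (hpos n) _
  have hu : Tendsto (fun n => t n ^ (-γ)) atTop atTop :=
    (tendsto_rpow_neg_nhdsGT_zero (neg_lt_zero.2 hγ)).comp
      (tendsto_nhdsWithin_iff.2 ⟨hlim, Eventually.of_forall hpos⟩)
  have hlim1 : Tendsto (fun n => t (n + 1)) atTop (𝓝 0) := hlim.comp (tendsto_add_atTop_nat 1)
  have hlimδ : Tendsto (fun n => C₂ * t (n + 1) ^ δ) atTop (𝓝 0) := by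
    have := (hlim1.rpow_const (Or.inr hδ.le)).const_mul C₂
    simpa [Real.zero_rpow hδ.ne'] using this
  obtain ⟨A, hA, hev⟩ := exists_linear_sub_rpow_le (u := fun n => t n ^ (-γ)) (a := a)
    (M := γ * (C₂ + C * ((1 + γ) * C))) (ρ := δ / γ) ha (by positivity) hρ hρ1 hupos hu (by
      filter_upwards [hlim1.eventually_le_const one_pos, hlimδ.eventually_le_const hC]
        with n h1 h2
      have e : (t (n + 1) ^ (-γ)) ^ (-(δ / γ)) = t (n + 1) ^ δ := by
        rw [← Real.rpow_mul (hpos _).le]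
        congr 1
        field_simp
      rw [e]
      exact rpow_neg_add_le_rpow_neg hγ hC hC₂ hδγ.le hδγ' (hpos _) h1 h2 (hrec n))
  have hsmall : Tendsto (fun n : ℕ => A / a * (n : ℝ) ^ (-(δ / γ))) atTop (𝓝 0) := by
    have := ((tendsto_rpow_neg_atTop hρ).comp tendsto_natCast_atTop_atTop).const_mul (A / a)
    simpa using this
  obtain ⟨N, hN⟩ := eventually_atTop.1
    (hev.and (hsmall.eventually_le_const (half_pos (one_pos (α := ℝ)))))
  refine ⟨1 / γ + δ / γ, by linarith, 0,
    a ^ (-(1 / γ)) * (2 * (1 / γ) * Real.exp (1 / γ) * (A / a)), by positivity, N + 1, by omega,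
    fun n hn => ?_⟩
  obtain ⟨h1, h2⟩ := hN n (by omega)
  have hn0 : (0 : ℝ) < n := by exact_mod_cast (show 0 < n by omega)
  set y := A / a * (n : ℝ) ^ (-(δ / γ)) with hy
  have hy0 : 0 ≤ y := by positivity
  have e1 : a * n - A * (n : ℝ) ^ (1 - δ / γ) = a * n * (1 - y) := by
    rw [hy, sub_eq_add_neg 1 (δ / γ), Real.rpow_add hn0, Real.rpow_one]
    field_simp
  have hy1 : 0 < 1 - y := by linarith
  have e2 : t n = (t n ^ (-γ)) ^ (-(1 / γ)) := by
    rw [← Real.rpow_mul (hpos n).le]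
    have : -γ * -(1 / γ) = 1 := by field_simp
    rw [this, Real.rpow_one]
  have hb : 0 < 1 / γ := by positivity
  have e3 : (n : ℝ) ^ (-(1 / γ + δ / γ)) = (n : ℝ) ^ (-(1 / γ)) * (n : ℝ) ^ (-(δ / γ)) := by
    rw [neg_add, Real.rpow_add hn0]
  have e4 : (a * n) ^ (-(1 / γ)) = a ^ (-(1 / γ)) * (n : ℝ) ^ (-(1 / γ)) :=
    Real.mul_rpow ha.le hn0.le
  rw [Nat.cast_zero, add_zero, e3]
  calc t n = (t n ^ (-γ)) ^ (-(1 / γ)) := e2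
    _ ≤ (a * n * (1 - y)) ^ (-(1 / γ)) :=
      Real.rpow_le_rpow_of_nonpos (by positivity) (e1 ▸ h1) (by linarith)
    _ = (a * n) ^ (-(1 / γ)) * (1 - y) ^ (-(1 / γ)) := Real.mul_rpow (by positivity) hy1.le
    _ ≤ (a * n) ^ (-(1 / γ)) * (1 + 2 * (1 / γ) * Real.exp (1 / γ) * y) :=
      mul_le_mul_of_nonneg_left (one_sub_rpow_neg_le hb.le hy0 (by linarith)) (by positivity)
    _ = _ := by rw [e4, hy]; ring
end

section
/- Let γ' > γ > 0, C > 0 and set β = 1/γ. Let (t_n)_{n≥0} be a sequence of positive reals with t_n → 0, and suppose there is a constant C₂ ≥ 0 such that t_{n-1} ≤ t_n + C·t_n^{1+γ} + C₂·t_n^{1+γ'} for all n ≥ 1. Then there exist β' > β, an integer k ≥ 0, a constant C₃ > 0 and N ≥ 1 such that t_n ≥ (γC(n+k))^{-β} − C₃·(n+k)^{-β'} for all n ≥ N. -/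
/-- Bernoulli's inequality for negative exponents. -/
theorem one_sub_mul_le_one_add_rpow_neg {p x : ℝ} (hp : 0 < p) (hx : 0 ≤ x) :
    1 - p * x ≤ (1 + x) ^ (-p) := by
  have hlog : Real.log (1 + x) ≤ x := by
    linarith [Real.log_le_sub_one_of_pos (show 0 < 1 + x by linarith)]
  rw [Real.rpow_def_of_pos (by linarith)]
  nlinarith [Real.add_one_le_exp (Real.log (1 + x) * -p)]

/-- A lower bound for the increments of a concave power. -/
theorem rpow_add_mul_rpow_sub_one_le {q x : ℝ} (hq : 0 ≤ q) (hq1 : q ≤ 1) (hx : 0 ≤ x) :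
    x ^ q + q * (x + 1) ^ (q - 1) ≤ (x + 1) ^ q := by
  have hx1 : 0 < x + 1 := by linarith
  have hB := rpow_one_add_le_one_add_mul_self (s := -(1 / (x + 1)))
    (by rw [neg_le_neg_iff, div_le_one hx1]; linarith) hq hq1
  have hfac : x = (x + 1) * (1 + -(1 / (x + 1))) := by field_simp; ring
  have hnn : 0 ≤ 1 + -(1 / (x + 1)) := by
    have : 1 / (x + 1) ≤ 1 := by rw [div_le_one hx1]; linarith
    linarith
  have hxq : x ^ q = (x + 1) ^ q * (1 + -(1 / (x + 1))) ^ q := by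
    rw [← Real.mul_rpow hx1.le hnn, ← hfac]
  have hmul := mul_le_mul_of_nonneg_left hB (Real.rpow_nonneg hx1.le q)
  rw [hxq, Real.rpow_sub_one hx1.ne']
  calc _ ≤ (x + 1) ^ q * (1 + q * -(1 / (x + 1))) + q * ((x + 1) ^ q / (x + 1)) := by linarith
    _ = (x + 1) ^ q := by ring

/-- The substitution `u = t ^ (-γ)` linearizes the recursion `r ≤ s + C s^(1+γ) + C₂ s^(1+γ')`. -/
theorem rpow_neg_le_of_le_add_rpow {γ γ' C C₂ r s : ℝ} (hγ : 0 < γ) (hC : 0 ≤ C) (hC₂ : 0 ≤ C₂)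
    (hr : 0 < r) (hs : 0 < s) (h : r ≤ s + C * s ^ (1 + γ) + C₂ * s ^ (1 + γ')) :
    s ^ (-γ) ≤ r ^ (-γ) + γ * C + γ * C₂ * s ^ (γ' - γ) := by
  have hx : 0 ≤ C * s ^ γ + C₂ * s ^ γ' := by positivity
  have hfac : s + C * s ^ (1 + γ) + C₂ * s ^ (1 + γ') = s * (1 + (C * s ^ γ + C₂ * s ^ γ')) := by
    rw [Real.rpow_add hs, Real.rpow_add hs, Real.rpow_one]; ring
  rw [hfac] at h
  have hpow := Real.rpow_le_rpow_of_nonpos hr h (neg_nonpos.mpr hγ.le)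
  rw [Real.mul_rpow hs.le (by linarith)] at hpow
  have hB := mul_le_mul_of_nonneg_left (one_sub_mul_le_one_add_rpow_neg hγ hx)
    (Real.rpow_nonneg hs.le (-γ))
  have hone : s ^ (-γ) * s ^ γ = 1 := by rw [← Real.rpow_add hs]; simp
  have hsub : s ^ (-γ) * s ^ γ' = s ^ (γ' - γ) := by rw [← Real.rpow_add hs]; ring_nf
  have hexp : s ^ (-γ) * (1 - γ * (C * s ^ γ + C₂ * s ^ γ'))
      = s ^ (-γ) - γ * C * (s ^ (-γ) * s ^ γ) - γ * C₂ * (s ^ (-γ) * s ^ γ') := by ring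
  rw [hexp, hone, hsub] at hB
  linarith

/-- A sequence whose increments are at most `a + D u^(-δ)` exceeds linear growth of rate `a`
by at most a sublinear power. -/
theorem le_linear_add_rpow_of_increment_le {a D δ η : ℝ} (ha : 0 < a) (hD : 0 ≤ D) (hη : 0 ≤ η)
    (hη1 : η < 1) (hηδ : η ≤ δ) {u : ℕ → ℝ} (hu : 0 ≤ u 0)
    (h : ∀ n, u (n + 1) ≤ u n + a + D * u (n + 1) ^ (-δ)) (n : ℕ) :
    u n ≤ a * n + D * a ^ (-δ) / (1 - η) * (n : ℝ) ^ (1 - η) + u 0 := by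
  have hη' : 0 < 1 - η := by linarith
  induction n with
  | zero => simp [Real.zero_rpow hη'.ne']
  | succ n ih =>
    push_cast
    have hn : (0 : ℝ) < n + 1 := by positivity
    have hB : 0 ≤ D * a ^ (-δ) / (1 - η) := by positivity
    rcases le_or_gt (u (n + 1)) (a * (n + 1)) with hle | hgt
    · have : 0 ≤ D * a ^ (-δ) / (1 - η) * ((n : ℝ) + 1) ^ (1 - η) := by positivity
      linarith
    · have h1 : u (n + 1) ^ (-δ) ≤ a ^ (-δ) * ((n : ℝ) + 1) ^ (-η) := by
        calc u (n + 1) ^ (-δ) ≤ (a * (n + 1)) ^ (-δ) :=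
              Real.rpow_le_rpow_of_nonpos (by positivity) hgt.le (by linarith)
          _ = a ^ (-δ) * ((n : ℝ) + 1) ^ (-δ) := Real.mul_rpow ha.le hn.le
          _ ≤ _ := by
              gcongr
              linarith [(Nat.cast_nonneg n : (0 : ℝ) ≤ n)]
      have h2 := mul_le_mul_of_nonneg_left h1 hD
      have h3 := mul_le_mul_of_nonneg_left (rpow_add_mul_rpow_sub_one_le hη'.le (by linarith)
        (Nat.cast_nonneg (α := ℝ) n)) hB
      have h4 : D * a ^ (-δ) / (1 - η) * ((n : ℝ) ^ (1 - η) + (1 - η) * (n + 1) ^ (1 - η - 1))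
          = D * a ^ (-δ) / (1 - η) * (n : ℝ) ^ (1 - η)
            + D * (a ^ (-δ) * ((n : ℝ) + 1) ^ (-η)) := by
        rw [show 1 - η - 1 = -η by ring]
        field_simp
      rw [h4] at h3
      linarith [h n]

/-- Negative powers of a sublinear perturbation of a linear function. -/
theorem rpow_neg_sub_le_rpow_neg_add {a B β η x : ℝ} (ha : 0 < a) (hB : 0 ≤ B) (hβ : 0 < β)
    (hx : 0 < x) :
    (a * x) ^ (-β) - β * (B / a) * a ^ (-β) * x ^ (-(β + η))
      ≤ (a * x + B * x ^ (1 - η)) ^ (-β) := by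
  have hfac : a * x + B * x ^ (1 - η) = (a * x) * (1 + B / a * x ^ (-η)) := by
    rw [sub_eq_add_neg, Real.rpow_add hx, Real.rpow_one]
    field_simp
  have hy : 0 ≤ B / a * x ^ (-η) := by positivity
  rw [hfac, Real.mul_rpow (mul_pos ha hx).le (by linarith : 0 ≤ 1 + B / a * x ^ (-η))]
  refine le_trans (le_of_eq ?_) (mul_le_mul_of_nonneg_left
    (one_sub_mul_le_one_add_rpow_neg hβ hy) (by positivity))
  rw [Real.mul_rpow ha.le hx.le, neg_add, Real.rpow_add hx]
  ring


/-- Lemma 3.1 of Hu–Vaienti (lower-bound direction): if a positive sequence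
`t n → 0` satisfies `t (n-1) ≤ t n + C t n ^ (1+γ) + C₂ t n ^ (1+γ')`, then
`t n ≥ (γ C (n+k))^{-1/γ} − C₃ (n+k)^{-β'}` eventually, with `β' > 1/γ`. -/
theorem stmt_1 (γ γ' C C₂ : ℝ) (hγ : 0 < γ) (hγγ' : γ < γ') (hC : 0 < C) (hC₂ : 0 ≤ C₂)
    (t : ℕ → ℝ) (hpos : ∀ n, 0 < t n)
    (hlim : Filter.Tendsto t Filter.atTop (nhds 0))
    (hrec : ∀ n : ℕ,
      t n ≤ t (n + 1) + C * t (n + 1) ^ (1 + γ) + C₂ * t (n + 1) ^ (1 + γ')) :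
    ∃ β' : ℝ, 1 / γ < β' ∧ ∃ k : ℕ, ∃ C₃ : ℝ, 0 < C₃ ∧ ∃ N : ℕ, 1 ≤ N ∧
      ∀ n : ℕ, N ≤ n →
        (γ * C * ((n : ℝ) + k)) ^ (-(1 / γ)) - C₃ * ((n : ℝ) + k) ^ (-β') ≤ t n := by
  set δ := (γ' - γ) / γ with hδ
  have hδ0 : 0 < δ := div_pos (by linarith) hγ
  set η := min δ (1 / 2) with hη
  have hη0 : 0 < η := lt_min hδ0 (by norm_num)
  have hη1 : η < 1 := (min_le_right _ _).trans_lt (by norm_num)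
  have ha : 0 < γ * C := mul_pos hγ hC
  have hu0 : 0 < t 0 ^ (-γ) := Real.rpow_pos_of_pos (hpos 0) _
  have hstep : ∀ n, t (n + 1) ^ (-γ)
      ≤ t n ^ (-γ) + γ * C + γ * C₂ * (t (n + 1) ^ (-γ)) ^ (-δ) := fun n ↦ by
    have hexp : -γ * -δ = γ' - γ := by rw [hδ]; field_simp
    rw [← Real.rpow_mul (hpos (n + 1)).le, hexp]
    exact rpow_neg_le_of_le_add_rpow hγ hC.le hC₂ (hpos n) (hpos (n + 1)) (hrec n)
  have hgrowth := le_linear_add_rpow_of_increment_le (u := fun n ↦ t n ^ (-γ)) ha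
    (mul_nonneg hγ.le hC₂) hη0.le hη1 (min_le_left _ _) hu0.le hstep
  set B := γ * C₂ * (γ * C) ^ (-δ) / (1 - η) with hB
  have hB0 : 0 ≤ B := by
    have : 0 < 1 - η := by linarith
    positivity
  refine ⟨1 / γ + η, by linarith, 0, 1 / γ * ((B + t 0 ^ (-γ)) / (γ * C)) * (γ * C) ^ (-(1 / γ)),
    by positivity, 1, le_rfl, fun n hn ↦ ?_⟩
  have hn1 : (1 : ℝ) ≤ n := by exact_mod_cast hn
  have hn0 : (0 : ℝ) < n := by linarith
  rw [Nat.cast_zero, add_zero]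
  refine (rpow_neg_sub_le_rpow_neg_add ha (by positivity) (by positivity) hn0).trans ?_
  have hle : t n ^ (-γ) ≤ γ * C * n + (B + t 0 ^ (-γ)) * (n : ℝ) ^ (1 - η) := by
    have hone : 1 ≤ (n : ℝ) ^ (1 - η) := Real.one_le_rpow hn1 (by linarith)
    nlinarith [hgrowth n]
  have hpow := Real.rpow_le_rpow_of_nonpos (Real.rpow_pos_of_pos (hpos n) _) hle
    (show -(1 / γ) ≤ 0 by rw [neg_nonpos]; positivity)
  have hexp : -γ * -(1 / γ) = 1 := by field_simp
  rwa [← Real.rpow_mul (hpos n).le, hexp, Real.rpow_one] at hpow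
end

section
/- Let a > 0, δ > 0 and C₂ ≥ 0, and let (r_i)_{i≥1} be a sequence of reals satisfying 0 ≤ r_i ≤ 1 − a/i + C₂·i^{-(1+δ)} for all i ≥ 1. Then there exists D > 0 such that for all integers 1 ≤ j ≤ n, the product ∏_{i=j}^{n} r_i ≤ D·(j/n)^{a}. -/
/-- `exp (-a / x)` is at most `(x / (x + 1)) ^ a`, the form of the bound that telescopes. -/
theorem exp_neg_div_le_rpow {a x : ℝ} (ha : 0 ≤ a) (hx : 0 < x) :
    Real.exp (-(a / x)) ≤ (x / (x + 1)) ^ a := by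
  have h : Real.exp (-(1 / x)) ≤ x / (x + 1) := by
    rw [Real.exp_neg, ← inv_div (x + 1) x]
    refine inv_anti₀ (by positivity) ?_
    calc (x + 1) / x = 1 / x + 1 := by field_simp; ring
      _ ≤ Real.exp (1 / x) := Real.add_one_le_exp _
  calc Real.exp (-(a / x)) = Real.exp (-(1 / x)) ^ a := by
        rw [← Real.exp_mul]; ring_nf
    _ ≤ (x / (x + 1)) ^ a := Real.rpow_le_rpow (Real.exp_pos _).le h ha

/-- A product of factors bounded by `1 - a / i + e i` telescopes, up to the exponential of the
sum of the errors. -/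
theorem prod_Icc_le_exp_sum_mul_rpow {a : ℝ} (ha : 0 ≤ a) {r e : ℕ → ℝ}
    (hr : ∀ i : ℕ, 1 ≤ i → 0 ≤ r i ∧ r i ≤ 1 - a / i + e i) {j n : ℕ} (hj : 1 ≤ j)
    (hjn : j ≤ n) :
    ∏ i ∈ Finset.Icc j n, r i ≤
      Real.exp (∑ i ∈ Finset.Icc j n, e i) * ((j : ℝ) / (n + 1)) ^ a := by
  have factor_le : ∀ i : ℕ, 1 ≤ i → r i ≤ Real.exp (e i) * ((i : ℝ) / (i + 1)) ^ a := by
    intro i hi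
    have hi0 : (0 : ℝ) < i := by exact_mod_cast hi
    calc r i ≤ (e i + -(a / i)) + 1 := by linarith [(hr i hi).2]
      _ ≤ Real.exp (e i + -(a / i)) := Real.add_one_le_exp _
      _ = Real.exp (e i) * Real.exp (-(a / i)) := Real.exp_add _ _
      _ ≤ _ := by gcongr; exact exp_neg_div_le_rpow ha hi0
  induction n, hjn using Nat.le_induction with
  | base => simpa using factor_le j hj
  | succ n hjn ih =>
    rw [Finset.prod_Icc_succ_top (by omega), Finset.sum_Icc_succ_top (by omega), Real.exp_add]
    refine (mul_le_mul ih (factor_le (n + 1) (by omega)) (hr (n + 1) (by omega)).1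
      (by positivity)).trans_eq ?_
    have h : (j : ℝ) / ((n + 1 : ℕ) + 1) = j / (n + 1) * ((n + 1 : ℕ) / ((n + 1 : ℕ) + 1)) := by
      push_cast
      field_simp
    rw [h, Real.mul_rpow (by positivity) (by positivity)]
    ring

/-- Lemma 3.2 of Hu–Vaienti (quantitative form): if `0 ≤ r i ≤ 1 − a/i + C₂ i^{-(1+δ)}`
for all `i ≥ 1`, then products of the `r i` over blocks `[j, n]` are bounded by
`D (j/n)^a`. -/
theorem stmt_2 (a δ C₂ : ℝ) (ha : 0 < a) (hδ : 0 < δ) (hC₂ : 0 ≤ C₂)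
    (r : ℕ → ℝ)
    (hr : ∀ i : ℕ, 1 ≤ i → 0 ≤ r i ∧ r i ≤ 1 - a / i + C₂ * (i : ℝ) ^ (-(1 + δ))) :
    ∃ D : ℝ, 0 < D ∧ ∀ j n : ℕ, 1 ≤ j → j ≤ n →
      ∏ i ∈ Finset.Icc j n, r i ≤ D * ((j : ℝ) / n) ^ a := by
  have hs : Summable fun i : ℕ => C₂ * (i : ℝ) ^ (-(1 + δ)) :=
    (Real.summable_nat_rpow.mpr (by linarith)).mul_left C₂
  refine ⟨Real.exp (∑' i : ℕ, C₂ * (i : ℝ) ^ (-(1 + δ))), Real.exp_pos _, fun j n hj hjn => ?_⟩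
  have hn : (0 : ℝ) < n := by exact_mod_cast hj.trans hjn
  refine (prod_Icc_le_exp_sum_mul_rpow ha.le hr hj hjn).trans ?_
  gcongr
  · exact hs.sum_le_tsum _ fun i _ => by positivity
  · linarith
end

section
/- Let a > 0, δ > 0 and C₂ ≥ 0, and let (r_i)_{i≥1} be a sequence of positive reals satisfying r_i ≥ 1 − a/i − C₂·i^{-(1+δ)} for all i ≥ 1. Then there exists D > 0 such that for all integers 1 ≤ j ≤ n with j large enough that the lower bounds are positive, the product ∏_{i=j}^{n} r_i ≥ D^{-1}·(j/n)^{a}. -/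
/-- If `r ≥ 1 - a x - c y` with `0 ≤ y ≤ x` small, then `log r + a log (1 + x)` is bounded below
by `-c y` up to a quadratic error. -/
theorem neg_le_log_add_mul_log {a c x y r : ℝ} (ha : 0 ≤ a) (hc : 0 ≤ c) (hx : 0 ≤ x)
    (hy : 0 ≤ y) (hyx : y ≤ x) (hsmall : (a + c) * x ≤ 1 / 2) (hr : 1 - a * x - c * y ≤ r) :
    -(c * y + (2 * (a + c) ^ 2 + a) * x ^ 2) ≤ Real.log r + a * Real.log (1 + x) := by
  set u := a * x + c * y with hu
  have hu0 : 0 ≤ u := by positivity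
  have hux : u ≤ (a + c) * x := by nlinarith
  have hu_sq : u ^ 2 ≤ (a + c) ^ 2 * x ^ 2 := by
    rw [← mul_pow]; gcongr
  have hpos : 0 < 1 - u := by linarith
  have hlog_r : -u - 2 * u ^ 2 ≤ Real.log r := by
    have h₁ : -u - 2 * u ^ 2 ≤ 1 - (1 - u)⁻¹ := by
      have : (1 - u)⁻¹ ≤ 1 + u + 2 * u ^ 2 := by
        rw [inv_le_iff_one_le_mul₀ hpos]
        nlinarith [mul_nonneg (sq_nonneg u) (by linarith : 0 ≤ 1 - 2 * u)]
      linarith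
    exact h₁.trans ((Real.one_sub_inv_le_log_of_pos hpos).trans
      (Real.log_le_log hpos (by linarith)))
  have hlog_x : x - x ^ 2 ≤ Real.log (1 + x) := by
    have hx1 : 0 < 1 + x := by linarith
    have : (1 + x)⁻¹ ≤ 1 - x + x ^ 2 := by
      rw [inv_le_iff_one_le_mul₀ hx1]
      nlinarith [pow_nonneg hx 3]
    linarith [Real.one_sub_inv_le_log_of_pos hx1]
  nlinarith [mul_le_mul_of_nonneg_left hlog_x ha]

theorem prod_Icc_div_succ_rpow (a : ℝ) {j n : ℕ} (hj : 1 ≤ j) (hjn : j ≤ n) :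
    ∏ i ∈ Finset.Icc j n, ((i : ℝ) / (i + 1)) ^ a = ((j : ℝ) / (n + 1)) ^ a := by
  induction n, hjn using Nat.le_induction with
  | base => simp
  | succ n hn ih =>
    rw [Finset.prod_Icc_succ_top (by omega), ih, ← Real.mul_rpow (by positivity) (by positivity)]
    congr 1
    push_cast
    field_simp

/-- The negative part of `log (r i) + a log (1 + 1 / i)` is summable. -/
theorem summable_neg_log_add_mul_log {a δ c : ℝ} (ha : 0 ≤ a) (hδ : 0 < δ) (hc : 0 ≤ c)
    {r : ℕ → ℝ} (hr : ∀ i : ℕ, 1 ≤ i → 1 - a / i - c * (i : ℝ) ^ (-(1 + δ)) ≤ r i) :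
    Summable fun i : ℕ => max 0 (-(Real.log (r i) + a * Real.log (1 + (i : ℝ)⁻¹))) := by
  have hsum : Summable fun i : ℕ =>
      c * (i : ℝ) ^ (-(1 + δ)) + (2 * (a + c) ^ 2 + a) * (i : ℝ)⁻¹ ^ 2 := by
    refine ((Real.summable_nat_rpow.2 (by linarith)).mul_left _).add (Summable.mul_left _ ?_)
    simp_rw [inv_pow]
    exact Real.summable_nat_pow_inv.2 one_lt_two
  refine Summable.of_norm_bounded_eventually_nat hsum ?_
  filter_upwards [Filter.eventually_ge_atTop 1,
    Filter.eventually_ge_atTop ⌈2 * (a + c)⌉₊] with i hi hi'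
  have hi1 : (1 : ℝ) ≤ i := by exact_mod_cast hi
  have hi2 : 2 * (a + c) ≤ i := Nat.ceil_le.1 hi'
  have hyx : (i : ℝ) ^ (-(1 + δ)) ≤ (i : ℝ)⁻¹ := by
    rw [← Real.rpow_neg_one]
    exact Real.rpow_le_rpow_of_exponent_le hi1 (by linarith)
  have hsmall : (a + c) * (i : ℝ)⁻¹ ≤ 1 / 2 := by
    rw [← div_eq_mul_inv, div_le_iff₀ (by linarith)]
    linarith
  have key := neg_le_log_add_mul_log ha hc (by positivity) (by positivity) hyx hsmall
    (by simpa [div_eq_mul_inv] using hr i hi)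
  rw [Real.norm_of_nonneg (le_max_left _ _)]
  exact max_le (by positivity) (by linarith)


/-- Lemma 3.2 of Hu–Vaienti, reversed direction: if `r i > 0` and
`r i ≥ 1 − a/i − C₂ i^{-(1+δ)}` for all `i ≥ 1`, then products of the `r i` over
blocks `[j, n]` on which the lower bounds are positive are bounded below by
`D⁻¹ (j/n)^a`. -/
theorem stmt_3 (a δ C₂ : ℝ) (ha : 0 < a) (hδ : 0 < δ) (hC₂ : 0 ≤ C₂)
    (r : ℕ → ℝ) (hpos : ∀ i : ℕ, 1 ≤ i → 0 < r i)
    (hr : ∀ i : ℕ, 1 ≤ i → 1 - a / i - C₂ * (i : ℝ) ^ (-(1 + δ)) ≤ r i) :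
    ∃ D : ℝ, 0 < D ∧ ∀ j n : ℕ, 1 ≤ j → j ≤ n →
      (∀ i : ℕ, j ≤ i → 0 < 1 - a / i - C₂ * (i : ℝ) ^ (-(1 + δ))) →
      D⁻¹ * ((j : ℝ) / n) ^ a ≤ ∏ i ∈ Finset.Icc j n, r i := by
  set e : ℕ → ℝ := fun i => max 0 (-(Real.log (r i) + a * Real.log (1 + (i : ℝ)⁻¹)))
  have hsum : Summable e := summable_neg_log_add_mul_log ha.le hδ hC₂ hr
  have hfactor : ∀ i : ℕ, 1 ≤ i → Real.exp (-e i) * ((i : ℝ) / (i + 1)) ^ a ≤ r i := by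
    intro i hi
    have hi0 : (0 : ℝ) < i := by exact_mod_cast hi
    have hlog : Real.log ((i : ℝ) / (i + 1)) = -Real.log (1 + (i : ℝ)⁻¹) := by
      rw [← Real.log_inv]
      congr 1
      field_simp
    rw [Real.rpow_def_of_pos (by positivity), ← Real.exp_add, hlog,
      ← Real.le_log_iff_exp_le (hpos i hi)]
    linarith [le_max_right 0 (-(Real.log (r i) + a * Real.log (1 + (i : ℝ)⁻¹)))]
  refine ⟨2 ^ a * Real.exp (∑' i, e i), by positivity, fun j n hj hjn _ => ?_⟩
  have hn : (1 : ℝ) ≤ n := by exact_mod_cast hj.trans hjn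
  calc (2 ^ a * Real.exp (∑' i, e i))⁻¹ * ((j : ℝ) / n) ^ a
      = Real.exp (-∑' i, e i) * ((j : ℝ) / (2 * n)) ^ a := by
        rw [Real.exp_neg, mul_inv, mul_comm (2 : ℝ), ← div_div,
          Real.div_rpow (by positivity) zero_le_two]
        ring
    _ ≤ Real.exp (-∑ i ∈ Finset.Icc j n, e i) * ((j : ℝ) / (n + 1)) ^ a := by
        gcongr
        · exact hsum.sum_le_tsum _ fun i _ => le_max_left _ _
        · linarith
    _ = ∏ i ∈ Finset.Icc j n, Real.exp (-e i) * ((i : ℝ) / (i + 1)) ^ a := by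
        rw [Finset.prod_mul_distrib, prod_Icc_div_succ_rpow a hj hjn, ← Real.exp_sum,
          Finset.sum_neg_distrib]
    _ ≤ ∏ i ∈ Finset.Icc j n, r i :=
        Finset.prod_le_prod (fun i _ => by positivity)
          fun i hi => hfactor i (hj.trans (Finset.mem_Icc.1 hi).1)
end

section
/- Let m ≥ 1, γ > 0, θ ∈ (0,1) and D̄₁, C̄₁', C̄₂ > 0. Let R̃ ⊂ ℝ^m be a bounded set containing the origin, and let T : R̃ → ℝ^m be an injective C¹ map with det DT(x) ≠ 0 for all x ∈ R̃, satisfying, for all x, y ∈ R̃ with ‖x−y‖^{1−θ} ≤ D̄₁‖x‖: (i) ‖Tx − Ty‖ ≥ (1 + C̄₁'‖x‖^γ)·‖x−y‖, and (ii) |log(|det DT(x)| / |det DT(y)|)| ≤ C̄₂·‖x‖^{γ−1}·‖x−y‖. Then there exists J' > 0 such that for every n ≥ 1 and all points x₀, x₁, …, x_n and y₀, y₁, …, y_n in R̃ with T(x_i) = x_{i−1}, T(y_i) = y_{i−1} and ‖x_i − y_i‖^{1−θ} ≤ D̄₁‖x_i‖ for i = 1, …, n, one has log( ∏_{i=1}^{n}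 |det DT(x_i)| / ∏_{i=1}^{n} |det DT(y_i)| ) ≤ J'·‖x₀ − y₀‖^{θ}. -/
/-- A linear lower bound, on a bounded interval, for a positive power of `1 + u`. -/
theorem one_add_mul_le_rpow_of_le {θ u U : ℝ} (hθ : 0 ≤ θ) (hu : 0 ≤ u) (huU : u ≤ U) :
    1 + θ / (1 + U) * u ≤ (1 + u) ^ θ := by
  have hpos : 0 < 1 + u := by linarith
  have hlog : u / (1 + U) ≤ Real.log (1 + u) := by
    refine le_trans ?_ (Real.one_sub_inv_le_log_of_pos hpos)
    calc u / (1 + U) ≤ u / (1 + u) := by gcongr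
      _ = 1 - (1 + u)⁻¹ := by field_simp; ring
  calc 1 + θ / (1 + U) * u = θ * (u / (1 + U)) + 1 := by ring
    _ ≤ Real.log (1 + u) * θ + 1 := by rw [mul_comm (Real.log _)]; gcongr
    _ ≤ Real.exp (Real.log (1 + u) * θ) := Real.add_one_le_exp _
    _ = (1 + u) ^ θ := (Real.rpow_def_of_pos hpos θ).symm

/-- If `d ^ (1 - θ) ≤ D * r`, then `r ^ (γ - 1) * d` is at most `D * r ^ γ * d ^ θ`. -/
theorem rpow_sub_one_mul_le {γ θ D r d : ℝ} (hD : 0 ≤ D) (hr : 0 ≤ r) (hd : 0 ≤ d)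
    (h : d ^ (1 - θ) ≤ D * r) : r ^ (γ - 1) * d ≤ D * r ^ γ * d ^ θ := by
  rcases hd.eq_or_lt with rfl | hd
  · rw [mul_zero]
    positivity
  · have hr : 0 < r := hr.lt_of_ne (by
      rintro rfl
      have := Real.rpow_pos_of_pos hd (1 - θ)
      linarith)
    calc r ^ (γ - 1) * d = r ^ (γ - 1) * (d ^ (1 - θ) * d ^ θ) := by
          rw [← Real.rpow_add hd, sub_add_cancel, Real.rpow_one]
      _ ≤ r ^ (γ - 1) * (D * r * d ^ θ) := by gcongr
      _ = D * r ^ γ * d ^ θ := by rw [Real.rpow_sub_one hr.ne']; field_simp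

/-- One step of the distortion estimate, in a form that telescopes along an orbit. -/
theorem distortion_step {γ θ D C K M r d e : ℝ} (hγ : 0 < γ) (hθ : 0 < θ)
    (hD : 0 < D) (hC : 0 < C) (hK : 0 < K) (hr : 0 ≤ r) (hrM : r ≤ M) (hd : 0 ≤ d)
    (h : d ^ (1 - θ) ≤ D * r) (he : (1 + C * r ^ γ) * d ≤ e) :
    K * r ^ (γ - 1) * d ≤ K * D * (1 + C * M ^ γ) / (θ * C) * (e ^ θ - d ^ θ) := by
  have hM : 0 ≤ M := hr.trans hrM
  have hgrow : (1 + θ / (1 + C * M ^ γ) * (C * r ^ γ)) * d ^ θ ≤ e ^ θ :=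
    calc (1 + θ / (1 + C * M ^ γ) * (C * r ^ γ)) * d ^ θ
        ≤ (1 + C * r ^ γ) ^ θ * d ^ θ := by
          gcongr
          exact one_add_mul_le_rpow_of_le hθ.le (by positivity) (by gcongr)
      _ = ((1 + C * r ^ γ) * d) ^ θ := (Real.mul_rpow (by positivity) hd).symm
      _ ≤ e ^ θ := by gcongr
  have hpos : 0 < 1 + C * M ^ γ := by positivity
  calc K * r ^ (γ - 1) * d = K * (r ^ (γ - 1) * d) := by ring
    _ ≤ K * (D * r ^ γ * d ^ θ) := by
        exact mul_le_mul_of_nonneg_left (rpow_sub_one_mul_le hD.le hr hd h) hK.le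
    _ = K * D * (1 + C * M ^ γ) / (θ * C) *
          (θ / (1 + C * M ^ γ) * (C * r ^ γ) * d ^ θ) := by field_simp
    _ ≤ K * D * (1 + C * M ^ γ) / (θ * C) * (e ^ θ - d ^ θ) := by
        gcongr
        linarith

/-- Lemma 3.3 of Hu–Vaienti: uniform distortion bound along backward orbits that
stay at proportional distance.  Here `x i = T^{-i} x₀` and `y i = T^{-i} y₀` are
encoded via `T (x i) = x (i-1)`, `T (y i) = y (i-1)`, and
`∏_{i=1}^n |det DT (x i)| = |det DT^n (x n)|` by the chain rule. -/
theorem stmt_4 (m : ℕ) (hm : 1 ≤ m) (γ θ D₁ C₁' C₂ : ℝ)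
    (hγ : 0 < γ) (hθ0 : 0 < θ) (hθ1 : θ < 1)
    (hD₁ : 0 < D₁) (hC₁' : 0 < C₁') (hC₂ : 0 < C₂)
    (R : Set (EuclideanSpace ℝ (Fin m))) (hRb : Bornology.IsBounded R)
    (h0R : (0 : EuclideanSpace ℝ (Fin m)) ∈ R)
    (T : EuclideanSpace ℝ (Fin m) → EuclideanSpace ℝ (Fin m))
    (hTinj : Set.InjOn T R)
    (hC1 : ContDiffOn ℝ 1 T R)
    (hTdiff : ∀ x ∈ R, DifferentiableAt ℝ T x)
    (hTdet : ∀ x ∈ R, (fderiv ℝ T x).det ≠ 0)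
    (hexp : ∀ x ∈ R, ∀ y ∈ R, ‖x - y‖ ^ (1 - θ) ≤ D₁ * ‖x‖ →
      (1 + C₁' * ‖x‖ ^ γ) * ‖x - y‖ ≤ ‖T x - T y‖)
    (hdist : ∀ x ∈ R, ∀ y ∈ R, ‖x - y‖ ^ (1 - θ) ≤ D₁ * ‖x‖ →
      |Real.log (|(fderiv ℝ T x).det| / |(fderiv ℝ T y).det|)| ≤
        C₂ * ‖x‖ ^ (γ - 1) * ‖x - y‖) :
    ∃ J' : ℝ, 0 < J' ∧ ∀ n : ℕ, 1 ≤ n → ∀ x y : ℕ → EuclideanSpace ℝ (Fin m),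
      (∀ i : ℕ, i ≤ n → x i ∈ R ∧ y i ∈ R) →
      (∀ i : ℕ, 1 ≤ i → i ≤ n → T (x i) = x (i - 1) ∧ T (y i) = y (i - 1) ∧
        ‖x i - y i‖ ^ (1 - θ) ≤ D₁ * ‖x i‖) →
      Real.log ((∏ i ∈ Finset.Icc 1 n, |(fderiv ℝ T (x i)).det|) /
          (∏ i ∈ Finset.Icc 1 n, |(fderiv ℝ T (y i)).det|)) ≤
        J' * ‖x 0 - y 0‖ ^ θ := by
  obtain ⟨M, hM0, hM⟩ := hRb.exists_pos_norm_le
  refine ⟨C₂ * D₁ * (1 + C₁' * M ^ γ) / (θ * C₁'), by positivity, fun n _ x y hR hxy => ?_⟩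
  set J := C₂ * D₁ * (1 + C₁' * M ^ γ) / (θ * C₁')
  have hJ0 : 0 ≤ J := by positivity
  suffices key : ∀ k ≤ n, Real.log ((∏ i ∈ Finset.Icc 1 k, |(fderiv ℝ T (x i)).det|) /
      (∏ i ∈ Finset.Icc 1 k, |(fderiv ℝ T (y i)).det|)) ≤
        J * (‖x 0 - y 0‖ ^ θ - ‖x k - y k‖ ^ θ) by
    refine (key n le_rfl).trans ?_
    gcongr
    exact sub_le_self _ (by positivity)
  intro k
  induction k with
  | zero => simp
  | succ k ih =>
    intro hk
    obtain ⟨hTx, hTy, hclose⟩ := hxy (k + 1) (by omega) hk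
    obtain ⟨hx, hy⟩ := hR (k + 1) hk
    have hne : ∀ z : ℕ → EuclideanSpace ℝ (Fin m), (∀ i ≤ n, z i ∈ R) →
        ∏ i ∈ Finset.Icc 1 k, |(fderiv ℝ T (z i)).det| ≠ 0 := fun z hz =>
      Finset.prod_ne_zero_iff.2 fun i hi =>
        abs_ne_zero.2 (hTdet _ (hz i (by have := (Finset.mem_Icc.1 hi).2; omega)))
    have hexp' := hexp _ hx _ hy hclose
    rw [hTx, hTy, Nat.add_sub_cancel] at hexp'
    have hstep := (le_abs_self _).trans ((hdist _ hx _ hy hclose).trans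
      (distortion_step hγ hθ0 hD₁ hC₁' hC₂ (norm_nonneg _) (hM _ hx) (norm_nonneg _)
        hclose hexp'))
    rw [Finset.prod_Icc_succ_top (by omega), Finset.prod_Icc_succ_top (by omega),
      mul_div_mul_comm, Real.log_mul
        (div_ne_zero (hne x fun i hi => (hR i hi).1) (hne y fun i hi => (hR i hi).2))
        (div_ne_zero (abs_ne_zero.2 (hTdet _ hx)) (abs_ne_zero.2 (hTdet _ hy)))]
    linarith [ih (by omega)]
end

section
/- Let ν be Lebesgue measure on ℝ^m, let f be a measurable essentially bounded function on ℝ^m, let S ⊂ ℝ^m be a Borel set, and let ε > 0. Then for every x ∈ ℝ^m: osc(f·χ_S, B_ε(x)) ≤ osc(f, S ∩ B_ε(x))·χ_S(x) + 2·(essSup_{S ∩ B_ε(x)} |f|)·χ_{B_ε(S) ∩ B_ε(S^c)}(x), where χ_A denotes the indicator function of A, B_ε(x) is the closed ball of radius ε about x, B_ε(A) = {y ∈ ℝ^m : d(y, A) ≤ ε}, and the terms involving S ∩ B_ε(x) are interpreted as 0 when ν(S ∩ B_ε(x)) = 0. -/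
open MeasureTheory

/-- The oscillation of `f` over `Ω`: the essential supremum minus the essential
infimum of `f` with respect to Lebesgue measure restricted to `Ω`.
(When `Ω` is Lebesgue-null this equals `0`.) -/
noncomputable def osc {m : ℕ} (f : EuclideanSpace ℝ (Fin m) → ℝ)
    (Ω : Set (EuclideanSpace ℝ (Fin m))) : ℝ :=
  essSup f (volume.restrict Ω) - essInf f (volume.restrict Ω)

theorem ae_abs_le_of_eLpNorm_top_lt_top {α : Type*} [MeasurableSpace α] {μ : Measure α}
    {f : α → ℝ} (hf : eLpNorm f ⊤ μ < ⊤) : ∃ C : ℝ, ∀ᵐ y ∂μ, |f y| ≤ C := by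
  rw [eLpNorm_exponent_top] at hf
  refine ⟨(eLpNormEssSup f μ).toReal, ?_⟩
  filter_upwards [enorm_ae_le_eLpNormEssSup f μ] with y hy
  simpa using ENNReal.toReal_mono hf.ne hy

theorem essSup_le_and_le_essInf_of_ae_abs_le {α : Type*} [MeasurableSpace α] {μ : Measure α}
    (hμ : μ ≠ 0) {f : α → ℝ} {M : ℝ} (h : ∀ᵐ y ∂μ, |f y| ≤ M) :
    essSup f μ ≤ M ∧ -M ≤ essInf f μ := by
  have : (ae μ).NeBot := ae_neBot.2 hμ
  have hu : ∀ᵐ y ∂μ, f y ≤ M := h.mono fun y hy => (abs_le.1 hy).2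
  have hl : ∀ᵐ y ∂μ, -M ≤ f y := h.mono fun y hy => (abs_le.1 hy).1
  have hbu : Filter.IsBoundedUnder (· ≤ ·) (ae μ) f := ⟨M, hu⟩
  have hbl : Filter.IsBoundedUnder (· ≥ ·) (ae μ) f := ⟨-M, hl⟩
  exact ⟨Filter.limsup_le_of_le hbl.isCoboundedUnder_le hu,
    Filter.le_liminf_of_le hbu.isCoboundedUnder_ge hl⟩

theorem essSup_real_measure_zero {α : Type*} [MeasurableSpace α] (f : α → ℝ) :
    essSup f (0 : Measure α) = 0 := by
  simp [essSup, Filter.limsup_eq]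

theorem essInf_real_measure_zero {α : Type*} [MeasurableSpace α] (f : α → ℝ) :
    essInf f (0 : Measure α) = 0 := by
  simp [essInf, Filter.liminf_eq]

theorem osc_nonneg {m : ℕ} {f : EuclideanSpace ℝ (Fin m) → ℝ}
    (hbd : eLpNorm f ⊤ volume < ⊤) (Ω : Set (EuclideanSpace ℝ (Fin m))) : 0 ≤ osc f Ω := by
  unfold osc
  rcases eq_or_ne (volume.restrict Ω) 0 with h0 | h0
  · simp [h0, essSup_real_measure_zero, essInf_real_measure_zero]
  · obtain ⟨C, hC⟩ := ae_abs_le_of_eLpNorm_top_lt_top hbd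
    have : (ae (volume.restrict Ω)).NeBot := ae_neBot.2 h0
    have hC' := ae_restrict_of_ae (s := Ω) hC
    exact sub_nonneg.2 (Filter.liminf_le_limsup
      ⟨C, hC'.mono fun y hy => (abs_le.1 hy).2⟩ ⟨-C, hC'.mono fun y hy => (abs_le.1 hy).1⟩)

theorem osc_congr {m : ℕ} {f g : EuclideanSpace ℝ (Fin m) → ℝ}
    {Ω : Set (EuclideanSpace ℝ (Fin m))} (hΩ : MeasurableSet Ω) (h : Set.EqOn f g Ω) :
    osc f Ω = osc g Ω := by
  have h' : f =ᵐ[volume.restrict Ω] g := ae_restrict_of_forall_mem hΩ h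
  rw [osc, osc, essSup_congr_ae h', essInf_congr_ae h']

theorem essSup_abs_nonneg {α : Type*} [MeasurableSpace α] {μ : Measure α} {f : α → ℝ}
    (hf : Filter.IsBoundedUnder (· ≤ ·) (ae μ) fun y => |f y|) :
    0 ≤ essSup (fun y => |f y|) μ := by
  rcases eq_or_ne μ 0 with rfl | h0
  · rw [essSup_real_measure_zero]
  · have : (ae μ).NeBot := ae_neBot.2 h0
    obtain ⟨y, hy⟩ := (ae_le_essSup hf).exists
    exact (abs_nonneg _).trans hy

theorem osc_indicator_le {m : ℕ} {f : EuclideanSpace ℝ (Fin m) → ℝ}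
    (hbd : eLpNorm f ⊤ volume < ⊤) {S Ω : Set (EuclideanSpace ℝ (Fin m))}
    (hS : MeasurableSet S) :
    osc (S.indicator f) Ω ≤ 2 * essSup (fun y => |f y|) (volume.restrict (S ∩ Ω)) := by
  obtain ⟨C, hC⟩ := ae_abs_le_of_eLpNorm_top_lt_top hbd
  have hb : Filter.IsBoundedUnder (· ≤ ·) (ae (volume.restrict (S ∩ Ω))) fun y => |f y| :=
    ⟨C, ae_restrict_of_ae hC⟩
  have hM := essSup_abs_nonneg hb
  rcases eq_or_ne (volume.restrict Ω) 0 with h0 | h0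
  · simpa [osc, h0, essSup_real_measure_zero, essInf_real_measure_zero] using hM
  have hle := ae_le_essSup hb
  rw [← Measure.restrict_restrict hS, ae_restrict_iff' hS, Measure.restrict_restrict hS] at hle
  have habs : ∀ᵐ y ∂volume.restrict Ω,
      |S.indicator f y| ≤ essSup (fun y => |f y|) (volume.restrict (S ∩ Ω)) := by
    filter_upwards [hle] with y hy
    by_cases hyS : y ∈ S
    · simpa [hyS] using hy hyS
    · simpa [hyS] using hM
  obtain ⟨h1, h2⟩ := essSup_le_and_le_essInf_of_ae_abs_le h0 habs
  unfold osc
  linarith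

/-- Proposition 5.1(ii) of Hu–Vaienti: oscillation of a truncation `f·χ_S` over a
ball `B_ε(x)` is controlled by the oscillation of `f` on `S ∩ B_ε(x)` plus a
boundary term supported on `B_ε(S) ∩ B_ε(Sᶜ)` (here `B_ε(A) = cthickening ε A`
is the set of points at distance `≤ ε` from `A`). -/
theorem stmt_6 {m : ℕ} (f : EuclideanSpace ℝ (Fin m) → ℝ) (hf : Measurable f)
    (hbd : eLpNorm f ⊤ volume < ⊤)
    (S : Set (EuclideanSpace ℝ (Fin m))) (hS : MeasurableSet S)
    (ε : ℝ) (hε : 0 < ε) (x : EuclideanSpace ℝ (Fin m)) :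
    osc (S.indicator f) (Metric.closedBall x ε) ≤
      osc f (S ∩ Metric.closedBall x ε) * S.indicator (fun _ => (1 : ℝ)) x +
        2 * essSup (fun y => |f y|)
            (volume.restrict (S ∩ Metric.closedBall x ε)) *
          (Metric.cthickening ε S ∩ Metric.cthickening ε Sᶜ).indicator
            (fun _ => (1 : ℝ)) x := by
  have hball : MeasurableSet (Metric.closedBall x ε) := Metric.isClosed_closedBall.measurableSet
  have hthick : ∀ A : Set (EuclideanSpace ℝ (Fin m)), x ∉ Metric.cthickening ε A →
      ∀ y ∈ Metric.closedBall x ε, y ∉ A := fun A hx y hy hyA =>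
    hx (Metric.mem_cthickening_of_dist_le x y ε A hyA (by rwa [dist_comm]))
  by_cases h : x ∈ Metric.cthickening ε S ∩ Metric.cthickening ε Sᶜ
  · have hfirst : 0 ≤ osc f (S ∩ Metric.closedBall x ε) * S.indicator (fun _ => (1 : ℝ)) x :=
      mul_nonneg (osc_nonneg hbd _) (Set.indicator_nonneg (fun _ _ => zero_le_one) x)
    rw [Set.indicator_of_mem h, mul_one]
    exact (osc_indicator_le hbd hS).trans (le_add_of_nonneg_left hfirst)
  rw [Set.indicator_of_notMem h, mul_zero, add_zero]
  by_cases hxS : x ∈ S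
  · have hsub : Metric.closedBall x ε ⊆ S := fun y hy => not_not.1 <|
      hthick Sᶜ (fun hc => h ⟨Metric.self_subset_cthickening S hxS, hc⟩) y hy
    rw [Set.indicator_of_mem hxS, mul_one, Set.inter_eq_right.2 hsub]
    exact (osc_congr hball fun y hy => Set.indicator_of_mem (hsub hy) f).le
  · have hnot := hthick S fun hc => h ⟨hc, Metric.self_subset_cthickening Sᶜ hxS⟩
    have hempty : S ∩ Metric.closedBall x ε = ∅ :=
      Set.eq_empty_of_forall_notMem fun y hy => hnot y hy.2 hy.1
    rw [Set.indicator_of_notMem hxS, mul_zero]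
    refine (osc_indicator_le hbd hS).trans ?_
    simp [hempty, essSup_real_measure_zero]
end

section
/- Let ν be Lebesgue measure on ℝ^m, let f and g be measurable essentially bounded functions on ℝ^m with g ≥ 0 almost everywhere, and let S ⊂ ℝ^m be a Borel set with ν(S) > 0. Then osc(f·g, S) ≤ osc(f, S)·(essSup_S g) + osc(g, S)·(essInf_S |f|). -/
open MeasureTheory

section EssentialBounds

variable {α : Type*} [MeasurableSpace α] {μ : Measure α}

lemma ae_mem_Icc_essInf_essSup {f : α → ℝ} {C : ℝ} (hf : ∀ᵐ x ∂μ, |f x| ≤ C) :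
    ∀ᵐ x ∂μ, f x ∈ Set.Icc (essInf f μ) (essSup f μ) := by
  have hle : ∀ᵐ x ∂μ, f x ≤ essSup f μ :=
    ae_le_essSup (Filter.isBoundedUnder_of_eventually_le (hf.mono fun _ h => (abs_le.1 h).2))
  have hge : ∀ᵐ x ∂μ, essInf f μ ≤ f x :=
    ae_essInf_le (Filter.isBoundedUnder_of_eventually_ge (hf.mono fun _ h => (abs_le.1 h).1))
  filter_upwards [hle, hge] with x h₁ h₂ using ⟨h₂, h₁⟩

lemma exists_ae_abs_le_of_eLpNorm_top_lt_top {f : α → ℝ} (hf : eLpNorm f ⊤ μ < ⊤) :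
    ∃ C : ℝ, ∀ᵐ x ∂μ, |f x| ≤ C := by
  refine ⟨(eLpNormEssSup f μ).toReal, ?_⟩
  rw [eLpNorm_exponent_top] at hf
  filter_upwards [enorm_ae_le_eLpNormEssSup f μ] with x hx
  simpa using ENNReal.toReal_mono hf.ne hx

variable [NeZero μ]

lemma essSup_le_of_ae_abs_le {f : α → ℝ} {C c : ℝ} (hf : ∀ᵐ x ∂μ, |f x| ≤ C)
    (h : ∀ᵐ x ∂μ, f x ≤ c) : essSup f μ ≤ c :=
  essSup_le_of_ae_le c h (Filter.IsBoundedUnder.isCoboundedUnder_le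
    (Filter.isBoundedUnder_of_eventually_ge (hf.mono fun _ h => (abs_le.1 h).1)))

lemma le_essInf_of_ae_abs_le {f : α → ℝ} {C c : ℝ} (hf : ∀ᵐ x ∂μ, |f x| ≤ C)
    (h : ∀ᵐ x ∂μ, c ≤ f x) : c ≤ essInf f μ :=
  le_essInf_of_ae_le c h (Filter.IsBoundedUnder.isCoboundedUnder_ge
    (Filter.isBoundedUnder_of_eventually_le (hf.mono fun _ h => (abs_le.1 h).2)))

lemma essSup_sub_essInf_le {f : α → ℝ} {C a b : ℝ} (hf : ∀ᵐ x ∂μ, |f x| ≤ C)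
    (h : ∀ᵐ x ∂μ, f x ∈ Set.Icc a b) : essSup f μ - essInf f μ ≤ b - a :=
  sub_le_sub (essSup_le_of_ae_abs_le hf (h.mono fun _ hx => hx.2))
    (le_essInf_of_ae_abs_le hf (h.mono fun _ hx => hx.1))

lemma essSup_sub_essInf_mul_le {f g : α → ℝ} {C D : ℝ} (hf : ∀ᵐ x ∂μ, |f x| ≤ C)
    (hg : ∀ᵐ x ∂μ, |g x| ≤ D) (hg0 : ∀ᵐ x ∂μ, 0 ≤ g x) :
    essSup (fun x => f x * g x) μ - essInf (fun x => f x * g x) μ ≤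
      (essSup f μ - essInf f μ) * essSup g μ +
        (essSup g μ - essInf g μ) * essInf (fun x => |f x|) μ := by
  have hfI := ae_mem_Icc_essInf_essSup hf
  have hgI := ae_mem_Icc_essInf_essSup hg
  have habs : ∀ᵐ x ∂μ, |(|f x|)| ≤ C := by simpa only [abs_abs] using hf
  have hfg : ∀ᵐ x ∂μ, |f x * g x| ≤ C * D := by
    filter_upwards [hf, hg] with x h₁ h₂
    rw [abs_mul]
    exact mul_le_mul h₁ h₂ (abs_nonneg _) ((abs_nonneg _).trans h₁)
  have hc0 : 0 ≤ essInf (fun x => |f x|) μ :=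
    le_essInf_of_ae_abs_le habs (.of_forall fun _ => abs_nonneg _)
  have hca : essInf f μ ≤ essInf (fun x => |f x|) μ :=
    le_essInf_of_ae_abs_le habs (hfI.mono fun _ h => h.1.trans (le_abs_self _))
  have hcA : -essSup f μ ≤ essInf (fun x => |f x|) μ :=
    le_essInf_of_ae_abs_le habs
      (hfI.mono fun _ h => (neg_le_neg h.2).trans (neg_le_abs _))
  have hb0 : 0 ≤ essInf g μ := le_essInf_of_ae_abs_le hg hg0
  have hbB : essInf g μ ≤ essSup g μ := by
    obtain ⟨x, hx⟩ := hgI.exists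
    exact hx.1.trans hx.2
  generalize essInf (fun x => |f x|) μ = c at *
  generalize essInf f μ = a at *
  generalize essSup f μ = A at *
  generalize essInf g μ = b at *
  generalize essSup g μ = B at *
  rcases le_total 0 a with ha | ha
  · refine (essSup_sub_essInf_le (a := a * b) (b := A * B) hfg ?_).trans ?_
    · filter_upwards [hfI, hgI] with x ⟨h₁, h₂⟩ ⟨h₃, h₄⟩
      exact ⟨mul_le_mul h₁ h₃ hb0 (ha.trans h₁),
        mul_le_mul h₂ h₄ (hb0.trans h₃) (ha.trans (h₁.trans h₂))⟩
    · nlinarith [mul_le_mul_of_nonneg_left hca (sub_nonneg.2 hbB)]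
  rcases le_total A 0 with hA | hA
  · refine (essSup_sub_essInf_le (a := a * B) (b := A * b) hfg ?_).trans ?_
    · filter_upwards [hfI, hgI] with x ⟨h₁, h₂⟩ ⟨h₃, h₄⟩
      constructor <;> nlinarith
    · nlinarith [mul_le_mul_of_nonneg_left hcA (sub_nonneg.2 hbB)]
  · refine (essSup_sub_essInf_le (a := a * B) (b := A * B) hfg ?_).trans ?_
    · filter_upwards [hfI, hgI] with x ⟨h₁, h₂⟩ ⟨h₃, h₄⟩
      constructor <;> nlinarith
    · nlinarith [mul_nonneg (sub_nonneg.2 hbB) hc0]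

end EssentialBounds

/-- Proposition 5.1(iii) of Hu–Vaienti: a product rule for oscillations. -/
theorem stmt_7 {m : ℕ} (f g : EuclideanSpace ℝ (Fin m) → ℝ)
    (hf : Measurable f) (hg : Measurable g)
    (hfbd : eLpNorm f ⊤ volume < ⊤) (hgbd : eLpNorm g ⊤ volume < ⊤)
    (hg0 : ∀ᵐ x ∂(volume : Measure (EuclideanSpace ℝ (Fin m))), 0 ≤ g x)
    (S : Set (EuclideanSpace ℝ (Fin m))) (hS : MeasurableSet S)
    (hSpos : 0 < volume S) :
    osc (fun x => f x * g x) S ≤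
      osc f S * essSup g (volume.restrict S) +
        osc g S * essInf (fun x => |f x|) (volume.restrict S) := by
  have : NeZero (volume.restrict S) := ⟨by simpa using hSpos.ne'⟩
  obtain ⟨C, hC⟩ := exists_ae_abs_le_of_eLpNorm_top_lt_top hfbd
  obtain ⟨D, hD⟩ := exists_ae_abs_le_of_eLpNorm_top_lt_top hgbd
  exact essSup_sub_essInf_mul_le (ae_restrict_of_ae hC) (ae_restrict_of_ae hD)
    (ae_restrict_of_ae hg0)
end

section
/- Let T : ℝ² → ℝ² be given by T(x,y) = (x(1+x²+y²), y(1+x²+y²)²). Then there exist constants c > 0 and ε > 0 such that for every z ∈ ℝ² with ‖z‖ ≤ ε and every vector v ∈ ℝ², ‖DT(z)·v‖ ≥ (1 + ‖z‖² − c‖z‖⁴)·‖v‖. -/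
/-- The planar map with an indifferent fixed point at the origin from
Examples 1 and 3 of Hu–Vaienti. -/
noncomputable def T : ℝ × ℝ → ℝ × ℝ :=
  fun p => (p.1 * (1 + p.1 ^ 2 + p.2 ^ 2), p.2 * (1 + p.1 ^ 2 + p.2 ^ 2) ^ 2)

/-- The Euclidean norm on `ℝ × ℝ`. -/
noncomputable def euclNorm (p : ℝ × ℝ) : ℝ := Real.sqrt (p.1 ^ 2 + p.2 ^ 2)

theorem euclNorm_nonneg (p : ℝ × ℝ) : 0 ≤ euclNorm p := Real.sqrt_nonneg _

theorem euclNorm_sq (p : ℝ × ℝ) : euclNorm p ^ 2 = p.1 ^ 2 + p.2 ^ 2 :=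
  Real.sq_sqrt (by positivity)

/-- Cauchy–Schwarz in the plane. -/
theorem dot_le_euclNorm_mul_euclNorm (p q : ℝ × ℝ) :
    p.1 * q.1 + p.2 * q.2 ≤ euclNorm p * euclNorm q := by
  refine abs_le_of_sq_le_sq' ?_ (mul_nonneg (euclNorm_nonneg p) (euclNorm_nonneg q)) |>.2
  rw [mul_pow, euclNorm_sq, euclNorm_sq]
  nlinarith [sq_nonneg (p.1 * q.2 - p.2 * q.1)]

/-- A lower bound on the quadratic form of a vector gives a lower bound on its image. -/
theorem mul_euclNorm_le_of_mul_sq_le_dot {L : ℝ} {w v : ℝ × ℝ}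
    (h : L * (v.1 ^ 2 + v.2 ^ 2) ≤ w.1 * v.1 + w.2 * v.2) :
    L * euclNorm v ≤ euclNorm w := by
  rcases (euclNorm_nonneg v).eq_or_lt with hv | hv
  · simpa [← hv] using euclNorm_nonneg w
  · refine le_of_mul_le_mul_right ?_ hv
    rw [mul_assoc, ← pow_two, euclNorm_sq]
    exact h.trans (dot_le_euclNorm_mul_euclNorm w v)

theorem fderiv_T_apply (z v : ℝ × ℝ) :
    fderiv ℝ T z v =
      ((1 + 3 * z.1 ^ 2 + z.2 ^ 2) * v.1 + 2 * z.1 * z.2 * v.2,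
        4 * z.1 * z.2 * (1 + z.1 ^ 2 + z.2 ^ 2) * v.1 +
          ((1 + z.1 ^ 2 + z.2 ^ 2) ^ 2 + 4 * z.2 ^ 2 * (1 + z.1 ^ 2 + z.2 ^ 2)) * v.2) := by
  have h₁ : HasFDerivAt (fun p : ℝ × ℝ => p.1) (ContinuousLinearMap.fst ℝ ℝ ℝ) z := hasFDerivAt_fst
  have h₂ : HasFDerivAt (fun p : ℝ × ℝ => p.2) (ContinuousLinearMap.snd ℝ ℝ ℝ) z := hasFDerivAt_snd
  have hs := ((h₁.pow 2).const_add 1).add (h₂.pow 2)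
  have hT : HasFDerivAt T _ z := (h₁.mul hs).prodMk (h₂.mul (hs.pow 2))
  rw [hT.fderiv]
  ext <;> simp <;> ring

theorem dot_fderiv_T_lower_bound (x y a b : ℝ) :
    (1 + (x ^ 2 + y ^ 2) - (x ^ 2 + y ^ 2) ^ 2) * (a ^ 2 + b ^ 2) ≤
      ((1 + 3 * x ^ 2 + y ^ 2) * a + 2 * x * y * b) * a +
        (4 * x * y * (1 + x ^ 2 + y ^ 2) * a +
          ((1 + x ^ 2 + y ^ 2) ^ 2 + 4 * y ^ 2 * (1 + x ^ 2 + y ^ 2)) * b) * b := by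
  have hxy : 0 ≤ (x ^ 2 + y ^ 2) * ((x ^ 2 + y ^ 2) * (a ^ 2 + b ^ 2) + 4 * (x * y) * (a * b)) := by
    refine mul_nonneg (by positivity) ?_
    nlinarith [sq_nonneg (x * a + y * b), sq_nonneg (x * b + y * a)]
  have hq : 0 ≤ 2 * (x * a) ^ 2 + 6 * (x * a) * (y * b) + 5 * (y * b) ^ 2 := by
    nlinarith [sq_nonneg (2 * (x * a) + 3 * (y * b)), sq_nonneg (y * b)]
  have hb : 0 ≤ b ^ 2 * (x ^ 2 + (x ^ 2 + y ^ 2) ^ 2 + 4 * y ^ 2 * (x ^ 2 + y ^ 2)) := by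
    positivity
  linarith

/-- The lower bound on the smallest singular value of `DT(z)` used in Example 3
of Hu–Vaienti: `‖DT(z) v‖ ≥ (1 + |z|² − c|z|⁴) ‖v‖` for `z` near the origin,
in Euclidean norms. -/
theorem stmt_13 :
    ∃ c : ℝ, 0 < c ∧ ∃ ε : ℝ, 0 < ε ∧
      ∀ z : ℝ × ℝ, euclNorm z ≤ ε → ∀ v : ℝ × ℝ,
        (1 + euclNorm z ^ 2 - c * euclNorm z ^ 4) * euclNorm v ≤
          euclNorm (fderiv ℝ T z v) := by
  refine ⟨1, one_pos, 1, one_pos, fun z _ v => mul_euclNorm_le_of_mul_sq_le_dot ?_⟩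
  rw [show euclNorm z ^ 4 = (euclNorm z ^ 2) ^ 2 by ring, euclNorm_sq, fderiv_T_apply, one_mul]
  exact dot_fderiv_T_lower_bound z.1 z.2 v.1 v.2
end

section
/- Let T : ℝ² → ℝ² be given by T(x,y) = (x(1+x²+y²), y(1+x²+y²)²). Let (z_n)_{n≥0} be any backward T-orbit with z₀ ≠ 0, i.e. T(z_n) = z_{n−1} for all n ≥ 1. Then for every η > 0 there exists N such that for all n ≥ N, (1−η)·(4n)^{-1/2} ≤ ‖z_n‖ ≤ (1+η)·(2n)^{-1/2}. -/
open Filter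

/-- One backward step of `T` changes the inverse squared norm `1 / u` by at least
`(2 + v) / (1 + v) ^ 2` and at most `4`, where `v` is the squared norm of the preimage. -/
lemma inv_sub_inv_bounds {u v : ℝ} (hv : 0 < v) (hlo : v * (1 + v) ^ 2 ≤ u)
    (hhi : u ≤ v * (1 + v) ^ 4) :
    (2 + v) / (1 + v) ^ 2 ≤ v⁻¹ - u⁻¹ ∧ v⁻¹ - u⁻¹ ≤ 4 := by
  have hu : 0 < u := lt_of_lt_of_le (by positivity) hlo
  constructor
  · have h : u⁻¹ ≤ (v * (1 + v) ^ 2)⁻¹ := inv_anti₀ (by positivity) hlo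
    have e : (2 + v) / (1 + v) ^ 2 = v⁻¹ - (v * (1 + v) ^ 2)⁻¹ := by
      field_simp
      ring
    linarith
  · have h : (v * (1 + v) ^ 4)⁻¹ ≤ u⁻¹ := inv_anti₀ hu hhi
    have e : v⁻¹ - (v * (1 + v) ^ 4)⁻¹ ≤ 4 := by
      have e' : v⁻¹ - (v * (1 + v) ^ 4)⁻¹ = ((1 + v) ^ 4 - 1) / (v * (1 + v) ^ 4) := by
        field_simp
      rw [e', div_le_iff₀ (by positivity)]
      have : 0 ≤ 10 * v ^ 2 + 20 * v ^ 3 + 15 * v ^ 4 + 4 * v ^ 5 := by positivity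
      nlinarith
    linarith

/-- The squared Euclidean norm of `T p` in terms of that of `p`. -/
lemma normSq_T_bounds (p : ℝ × ℝ) :
    (p.1 ^ 2 + p.2 ^ 2) * (1 + (p.1 ^ 2 + p.2 ^ 2)) ^ 2 ≤ (T p).1 ^ 2 + (T p).2 ^ 2 ∧
      (T p).1 ^ 2 + (T p).2 ^ 2 ≤ (p.1 ^ 2 + p.2 ^ 2) * (1 + (p.1 ^ 2 + p.2 ^ 2)) ^ 4 := by
  obtain ⟨x, y⟩ := p
  simp only [T]
  have hs : 1 ≤ 1 + (x ^ 2 + y ^ 2) := by nlinarith [sq_nonneg x, sq_nonneg y]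
  have hpow : (1 + (x ^ 2 + y ^ 2)) ^ 2 ≤ (1 + (x ^ 2 + y ^ 2)) ^ 4 :=
    pow_le_pow_right₀ hs (by norm_num)
  have e : (x * (1 + x ^ 2 + y ^ 2)) ^ 2 + (y * (1 + x ^ 2 + y ^ 2) ^ 2) ^ 2 =
      x ^ 2 * (1 + (x ^ 2 + y ^ 2)) ^ 2 + y ^ 2 * (1 + (x ^ 2 + y ^ 2)) ^ 4 := by ring
  rw [e, add_mul, add_mul]
  constructor <;> gcongr

lemma add_mul_le_of_le_sub {w : ℕ → ℝ} {c : ℝ} {M : ℕ}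
    (h : ∀ n, M ≤ n → c ≤ w (n + 1) - w n) (n : ℕ) (hn : M ≤ n) :
    w M + c * ((n : ℝ) - M) ≤ w n := by
  induction n, hn using Nat.le_induction with
  | base => simp
  | succ n hn ih =>
    have := h n hn
    push_cast
    linarith

lemma le_add_mul_of_sub_le {w : ℕ → ℝ} {c : ℝ} (h : ∀ n, w (n + 1) - w n ≤ c) (n : ℕ) :
    w n ≤ w 0 + c * n := by
  induction n with
  | zero => simp
  | succ n ih =>
    have := h n
    push_cast
    linarith

lemma tendsto_atTop_of_le_sub {w : ℕ → ℝ} {c : ℝ} (hc : 0 < c)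
    (h : ∀ n, c ≤ w (n + 1) - w n) : Tendsto w atTop atTop := by
  refine tendsto_atTop_mono (fun n => ?_)
    (tendsto_atTop_add_const_left atTop (w 0)
      (tendsto_natCast_atTop_atTop.const_mul_atTop hc))
  simpa using add_mul_le_of_le_sub (M := 0) (fun n _ => h n) n n.zero_le

/-- If the increments of `w` are eventually at least `c`, then `w` eventually dominates every
linear function of slope smaller than `c`. -/
lemma eventually_mul_le_of_eventually_le_sub {w : ℕ → ℝ} {b c : ℝ} (hbc : b < c)
    (h : ∀ᶠ n in atTop, c ≤ w (n + 1) - w n) : ∀ᶠ n : ℕ in atTop, b * n ≤ w n := by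
  obtain ⟨M, hM⟩ := eventually_atTop.1 h
  have hlin : Tendsto (fun n : ℕ => (c - b) * (n : ℝ)) atTop atTop :=
    tendsto_natCast_atTop_atTop.const_mul_atTop (sub_pos.2 hbc)
  filter_upwards [hlin.eventually_ge_atTop (c * M - w M), eventually_ge_atTop M] with n hn hMn
  have := add_mul_le_of_le_sub hM n hMn
  linarith

/-- Growth of the inverses of a positive sequence obeying the squared-norm recursion. -/
lemma inv_growth {u : ℕ → ℝ} (hpos : ∀ n, 0 < u n)
    (hlo : ∀ n, u (n + 1) * (1 + u (n + 1)) ^ 2 ≤ u n)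
    (hhi : ∀ n, u n ≤ u (n + 1) * (1 + u (n + 1)) ^ 4) :
    (∀ n : ℕ, (u n)⁻¹ ≤ (u 0)⁻¹ + 4 * n) ∧
      ∀ b < 2, ∀ᶠ n : ℕ in atTop, b * n ≤ (u n)⁻¹ := by
  have hstep n := inv_sub_inv_bounds (hpos (n + 1)) (hlo n) (hhi n)
  refine ⟨le_add_mul_of_sub_le (w := fun n => (u n)⁻¹) fun n => (hstep n).2, fun b hb => ?_⟩
  have hanti : Antitone u := antitone_nat_of_succ_le fun n => by
    have hp := hpos (n + 1)
    refine le_trans ?_ (hlo n)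
    exact le_mul_of_one_le_right hp.le (one_le_pow₀ (by linarith))
  have hinf : Tendsto (fun n => (u n)⁻¹) atTop atTop := by
    have h0 := hpos 0
    refine tendsto_atTop_of_le_sub (c := 2 / (1 + u 0) ^ 2) (by positivity) fun n => ?_
    have hp := hpos (n + 1)
    have hle := hanti (n + 1).zero_le
    refine le_trans ?_ (hstep n).1
    gcongr
    linarith
  have hzero : Tendsto u atTop (nhds 0) := by
    simpa [Function.comp_def] using tendsto_inv_atTop_zero.comp hinf
  have hcont : Tendsto (fun n => (2 + u (n + 1)) / (1 + u (n + 1)) ^ 2) atTop (nhds 2) := by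
    have h1 := hzero.comp (tendsto_add_atTop_nat 1)
    simpa [Function.comp_def, Pi.div_def] using
      (h1.const_add 2).div ((h1.const_add 1).pow 2) (by norm_num)
  obtain ⟨c, hbc, hc⟩ := exists_between hb
  refine eventually_mul_le_of_eventually_le_sub hbc ?_
  filter_upwards [hcont.eventually_const_le hc] with n hn
  exact hn.trans (hstep n).1

lemma rpow_neg_half_eq {t : ℝ} (ht : 0 ≤ t) : t ^ (-(1 / 2) : ℝ) = √(t⁻¹) := by
  rw [Real.rpow_neg ht, Real.sqrt_inv, Real.sqrt_eq_rpow]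

lemma sq_norm_pos {z : ℕ → ℝ × ℝ} (hz0 : z 0 ≠ 0) (hback : ∀ n, T (z (n + 1)) = z n) (n : ℕ) :
    0 < (z n).1 ^ 2 + (z n).2 ^ 2 := by
  have hne : z n ≠ 0 := by
    induction n with
    | zero => exact hz0
    | succ n ih =>
      intro h
      apply ih
      rw [← hback n, h]
      simp [T]
  by_contra! hle
  apply hne
  ext
  · exact pow_eq_zero_iff two_ne_zero |>.1 (by nlinarith [sq_nonneg (z n).1, sq_nonneg (z n).2])
  · exact pow_eq_zero_iff two_ne_zero |>.1 (by nlinarith [sq_nonneg (z n).1, sq_nonneg (z n).2])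

/-- Formula (f2.4) of Hu–Vaienti: along any backward `T`-orbit of a nonzero
point, `(1−η)(4n)^{-1/2} ≤ |z_n| ≤ (1+η)(2n)^{-1/2}` for all large `n`. -/
theorem stmt_14 (z : ℕ → ℝ × ℝ) (hz0 : z 0 ≠ 0)
    (hback : ∀ n : ℕ, T (z (n + 1)) = z n) :
    ∀ η : ℝ, 0 < η → ∃ N : ℕ, ∀ n : ℕ, N ≤ n →
      (1 - η) * (4 * (n : ℝ)) ^ (-(1 / 2) : ℝ) ≤ euclNorm (z n) ∧
      euclNorm (z n) ≤ (1 + η) * (2 * (n : ℝ)) ^ (-(1 / 2) : ℝ) := by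
  intro η hη
  set u : ℕ → ℝ := fun n => (z n).1 ^ 2 + (z n).2 ^ 2
  have hpos : ∀ n, 0 < u n := sq_norm_pos hz0 hback
  have hT n := normSq_T_bounds (z (n + 1))
  simp only [hback] at hT
  obtain ⟨hupper, hlower⟩ := inv_growth hpos (fun n => (hT n).1) (fun n => (hT n).2)
  have hb : 2 / (1 + η) ^ 2 < 2 := by
    rw [div_lt_iff₀ (by positivity)]
    nlinarith
  rw [← eventually_atTop]
  have hlin : Tendsto (fun n : ℕ => η * (4 * (n : ℝ))) atTop atTop :=
    (tendsto_natCast_atTop_atTop.const_mul_atTop four_pos).const_mul_atTop hη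
  filter_upwards [hlower _ hb, hlin.eventually_ge_atTop (u 0)⁻¹, eventually_gt_atTop 0]
    with n hn2 hn4 hn
  have hn' : (0 : ℝ) < n := Nat.cast_pos.2 hn
  have hun := hpos n
  rw [rpow_neg_half_eq (by positivity), rpow_neg_half_eq (by positivity)]
  change (1 - η) * √(4 * (n : ℝ))⁻¹ ≤ √(u n) ∧ √(u n) ≤ (1 + η) * √(2 * (n : ℝ))⁻¹
  constructor
  · rcases le_or_gt 1 η with h1 | h1
    · exact (mul_nonpos_of_nonpos_of_nonneg (by linarith) (Real.sqrt_nonneg _)).trans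
        (Real.sqrt_nonneg _)
    · apply Real.le_sqrt_of_sq_le
      rw [mul_pow, Real.sq_sqrt (by positivity), ← div_eq_mul_inv, div_le_iff₀ (by positivity)]
      have hw : 1 ≤ u n * ((1 + η) * (4 * n)) := by
        rw [← inv_le_iff_one_le_mul₀' hun]
        linarith [hupper n]
      have hfac : (1 - η) ^ 2 * (1 + η) ≤ 1 := by
        nlinarith [mul_nonneg hη.le (sub_nonneg.2 h1.le), mul_pos hη hη]
      have hun4 : 0 < u n * (4 * n) := by positivity
      nlinarith [mul_le_mul_of_nonneg_left hw (sq_nonneg (1 - η)),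
        mul_le_mul_of_nonneg_left hfac hun4.le]
  · refine Real.sqrt_le_iff.2 ⟨by positivity, ?_⟩
    rw [mul_pow, Real.sq_sqrt (by positivity), ← div_eq_mul_inv, le_div_iff₀ (by positivity)]
    rw [div_mul_eq_mul_div, div_le_iff₀ (by positivity), ← div_eq_inv_mul,
      le_div_iff₀ hun] at hn2
    linarith
end

section
/- Let T : ℝ² → ℝ² be given by T(x,y) = (x(1+x²+y²), y(1+x²+y²)²). Let f(x) = x(1+x²) and g(y) = y(1+y²)², and fix x₀ > 0 and y₀ > 0. Let (x_n)_{n≥0} and (y_n)_{n≥0} be the backward orbits determined by f(x_n) = x_{n−1} and g(y_n) = y_{n−1} for n ≥ 1 (these exist and are unique since f and g are increasing bijections of [0,∞)). Then the ratio of distortion products ( ∏_{i=1}^{n} det DT(x_i, 0) ) / ( ∏_{i=1}^{n} det DT(0, y_i) ) tends to infinity as n → ∞. -/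
/-- The action of `T` on the (invariant) `x`-axis. -/
noncomputable def f (x : ℝ) : ℝ := x * (1 + x ^ 2)

/-- The action of `T` on the (invariant) `y`-axis. -/
noncomputable def g (y : ℝ) : ℝ := y * (1 + y ^ 2) ^ 2

theorem ContinuousLinearMap.det_real_prod (L : ℝ × ℝ →L[ℝ] ℝ × ℝ) :
    L.det = (L (1, 0)).1 * (L (0, 1)).2 - (L (0, 1)).1 * (L (1, 0)).2 := by
  rw [ContinuousLinearMap.det, ← LinearMap.det_toMatrix (Module.Basis.finTwoProd ℝ),
    Matrix.det_fin_two]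
  simp [LinearMap.toMatrix_apply]

theorem det_fderiv_T (a b : ℝ) :
    (fderiv ℝ T (a, b)).det =
      (1 + 3 * a ^ 2 + b ^ 2) * ((1 + a ^ 2 + b ^ 2) * (1 + a ^ 2 + 5 * b ^ 2)) -
        2 * a * b * (4 * a * b * (1 + a ^ 2 + b ^ 2)) := by
  have h1 : HasFDerivAt (fun p : ℝ × ℝ => p.1) (ContinuousLinearMap.fst ℝ ℝ ℝ) (a, b) :=
    hasFDerivAt_fst
  have h2 : HasFDerivAt (fun p : ℝ × ℝ => p.2) (ContinuousLinearMap.snd ℝ ℝ ℝ) (a, b) :=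
    hasFDerivAt_snd
  have hr := ((h1.pow 2).const_add 1).add (h2.pow 2)
  have hT : HasFDerivAt T _ (a, b) := (h1.mul hr).prodMk (h2.mul (hr.pow 2))
  rw [hT.fderiv, ContinuousLinearMap.det_real_prod]
  simp
  ring

theorem det_fderiv_T_left (a : ℝ) :
    (fderiv ℝ T (a, 0)).det = (1 + 3 * a ^ 2) * (1 + a ^ 2) ^ 2 := by
  rw [det_fderiv_T]; ring

theorem det_fderiv_T_right (b : ℝ) :
    (fderiv ℝ T (0, b)).det = (1 + b ^ 2) ^ 2 * (1 + 5 * b ^ 2) := by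
  rw [det_fderiv_T]; ring

theorem pos_of_backward_orbit_f {x : ℕ → ℝ} (h0 : 0 < x 0) (hx : ∀ n, f (x (n + 1)) = x n)
    (n : ℕ) : 0 < x n := by
  induction n with
  | zero => exact h0
  | succ n ih =>
    rw [← hx n, f] at ih
    exact pos_of_mul_pos_left ih (by positivity)

theorem pos_of_backward_orbit_g {y : ℕ → ℝ} (h0 : 0 < y 0) (hy : ∀ n, g (y (n + 1)) = y n)
    (n : ℕ) : 0 < y n := by
  induction n with
  | zero => exact h0
  | succ n ih =>
    rw [← hy n, g] at ih
    exact pos_of_mul_pos_left ih (by positivity)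

theorem antitone_of_backward_orbit_f {x : ℕ → ℝ} (h0 : 0 < x 0)
    (hx : ∀ n, f (x (n + 1)) = x n) : Antitone x := by
  refine antitone_nat_of_succ_le fun n => ?_
  have h := pos_of_backward_orbit_f h0 hx (n + 1)
  rw [← hx n, f]
  nlinarith [pow_pos h 3]

/-- Along a backward orbit of `f`, the quantity `1 / x_n ^ 2` grows at least linearly. -/
theorem linear_le_inv_sq_of_backward_orbit_f {x : ℕ → ℝ} (h0 : 0 < x 0)
    (hx : ∀ n, f (x (n + 1)) = x n) (n : ℕ) :
    (1 + x 0 ^ 2)⁻¹ * n ≤ (x n ^ 2)⁻¹ := by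
  induction n with
  | zero => simp only [Nat.cast_zero, mul_zero]; positivity
  | succ n ih =>
    have h := pos_of_backward_orbit_f h0 hx (n + 1)
    have hle := antitone_of_backward_orbit_f h0 hx (Nat.zero_le (n + 1))
    have hc : (1 + x 0 ^ 2)⁻¹ ≤ (1 + x (n + 1) ^ 2)⁻¹ := by gcongr
    have key : (x n ^ 2)⁻¹ + (1 + x (n + 1) ^ 2)⁻¹ ≤ (x (n + 1) ^ 2)⁻¹ := by
      rw [← hx n, f, mul_pow]
      have hs : 0 < x (n + 1) ^ 2 := by positivity
      generalize x (n + 1) ^ 2 = s at hs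
      have : s⁻¹ - ((s * (1 + s) ^ 2)⁻¹ + (1 + s)⁻¹) = (1 + s)⁻¹ ^ 2 := by
        field_simp; ring
      linarith [sq_nonneg (1 + s)⁻¹]
    push_cast
    linarith

/-- Along a backward orbit of `g`, the quantity `1 / y_n ^ 2` grows at most linearly. -/
theorem inv_sq_le_linear_of_backward_orbit_g {y : ℕ → ℝ} (h0 : 0 < y 0)
    (hy : ∀ n, g (y (n + 1)) = y n) (n : ℕ) :
    (y n ^ 2)⁻¹ ≤ (y 0 ^ 2)⁻¹ + 4 * n := by
  induction n with
  | zero => simp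
  | succ n ih =>
    have h := pos_of_backward_orbit_g h0 hy (n + 1)
    have key : (y (n + 1) ^ 2)⁻¹ ≤ (y n ^ 2)⁻¹ + 4 := by
      rw [← hy n, g, mul_pow, ← pow_mul]
      have hs : 0 < y (n + 1) ^ 2 := by positivity
      generalize y (n + 1) ^ 2 = s at hs
      have : (s * (1 + s) ^ (2 * 2))⁻¹ + 4 - s⁻¹ =
          (1 + 4 * s * (1 + s) ^ 4 - (1 + s) ^ 4) / (s * (1 + s) ^ 4) := by
        field_simp
      have hnum : 0 ≤ 1 + 4 * s * (1 + s) ^ 4 - (1 + s) ^ 4 := by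
        ring_nf; positivity
      have := div_nonneg hnum (by positivity : 0 ≤ s * (1 + s) ^ 4)
      linarith
    push_cast
    linarith

theorem eventually_const_le_prod_mul_pow {x : ℕ → ℝ} (h0 : 0 < x 0)
    (hx : ∀ n, f (x (n + 1)) = x n) :
    ∃ K > 0, ∀ᶠ n in Filter.atTop,
      K ≤ (∏ i ∈ Finset.Icc 1 n, (fderiv ℝ T (x i, 0)).det) * x n ^ 4 := by
  simp only [det_fderiv_T_left]
  obtain ⟨N, hN⟩ := exists_nat_ge (1 + x 0 ^ 2)
  have hpos := pos_of_backward_orbit_f h0 hx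
  refine ⟨(∏ i ∈ Finset.Icc 1 N, (1 + 3 * x i ^ 2) * (1 + x i ^ 2) ^ 2) * x N ^ 4,
    mul_pos (Finset.prod_pos fun i _ => by positivity) (pow_pos (hpos N) 4), ?_⟩
  filter_upwards [Filter.eventually_ge_atTop N] with n hn
  induction n, hn using Nat.le_induction with
  | base => rfl
  | succ n hn ih =>
    refine ih.trans ?_
    rw [Finset.prod_Icc_succ_top (by omega), mul_assoc]
    have hP : 0 ≤ ∏ i ∈ Finset.Icc 1 n, (1 + 3 * x i ^ 2) * (1 + x i ^ 2) ^ 2 :=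
      Finset.prod_nonneg fun i _ => by positivity
    refine mul_le_mul_of_nonneg_left ?_ hP
    have h := hpos (n + 1)
    have hs1 : x (n + 1) ^ 2 ≤ 1 := by
      have hlin := linear_le_inv_sq_of_backward_orbit_f h0 hx (n + 1)
      have hn' : 1 + x 0 ^ 2 ≤ ((n + 1 : ℕ) : ℝ) :=
        hN.trans (by exact_mod_cast (by omega : N ≤ n + 1))
      have h1 : 1 ≤ (1 + x 0 ^ 2)⁻¹ * ((n + 1 : ℕ) : ℝ) := by
        rw [inv_mul_eq_div, one_le_div (by positivity)]
        exact hn'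
      exact (one_le_inv₀ (by positivity)).1 (h1.trans hlin)
    have hfac : (1 + x (n + 1) ^ 2) ^ 2 ≤ 1 + 3 * x (n + 1) ^ 2 := by
      nlinarith [sq_nonneg (x (n + 1))]
    calc x n ^ 4 = (1 + x (n + 1) ^ 2) ^ 2 * ((1 + x (n + 1) ^ 2) ^ 2 * x (n + 1) ^ 4) := by
          rw [← hx n, f]; ring
      _ ≤ (1 + 3 * x (n + 1) ^ 2) * ((1 + x (n + 1) ^ 2) ^ 2 * x (n + 1) ^ 4) := by gcongr
      _ = _ := by ring

theorem prod_pow_mul_pow_le {y : ℕ → ℝ} (h0 : 0 < y 0)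
    (hy : ∀ n, g (y (n + 1)) = y n) (n : ℕ) :
    (∏ i ∈ Finset.Icc 1 n, (fderiv ℝ T (0, y i)).det) ^ 4 * y n ^ 14 ≤ y 0 ^ 14 := by
  simp only [det_fderiv_T_right]
  induction n with
  | zero => simp
  | succ n ih =>
    refine le_trans ?_ ih
    rw [Finset.prod_Icc_succ_top (by omega), mul_pow, mul_assoc]
    refine mul_le_mul_of_nonneg_left ?_ (by positivity)
    have h := pos_of_backward_orbit_g h0 hy (n + 1)
    have hfac : 1 + 5 * y (n + 1) ^ 2 ≤ (1 + y (n + 1) ^ 2) ^ 5 := by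
      have hb := one_add_mul_le_pow (a := y (n + 1) ^ 2) (by nlinarith [sq_nonneg (y (n + 1))]) 5
      exact_mod_cast hb
    calc ((1 + y (n + 1) ^ 2) ^ 2 * (1 + 5 * y (n + 1) ^ 2)) ^ 4 * y (n + 1) ^ 14
        ≤ ((1 + y (n + 1) ^ 2) ^ 2 * (1 + y (n + 1) ^ 2) ^ 5) ^ 4 * y (n + 1) ^ 14 := by gcongr
      _ = y n ^ 14 := by rw [← hy n, g]; ring

/-- Example 1 of Hu–Vaienti: unbounded distortion away from the indifferent
fixed point.  For backward orbits `(x_n, 0)` and `(0, y_n)` on the two axes,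
the ratio `(∏_{i=1}^n det DT(x_i,0)) / (∏_{i=1}^n det DT(0,y_i))`
(which equals `|det DT^{-n}(0,y₀)| / |det DT^{-n}(x₀,0)|`) tends to infinity. -/
theorem stmt_15 (x₀ y₀ : ℝ) (hx₀ : 0 < x₀) (hy₀ : 0 < y₀)
    (x y : ℕ → ℝ) (hx0 : x 0 = x₀) (hy0 : y 0 = y₀)
    (hxb : ∀ n : ℕ, f (x (n + 1)) = x n)
    (hyb : ∀ n : ℕ, g (y (n + 1)) = y n) :
    Filter.Tendsto
      (fun n : ℕ =>
        (∏ i ∈ Finset.Icc 1 n, (fderiv ℝ T (x i, 0)).det) /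
          (∏ i ∈ Finset.Icc 1 n, (fderiv ℝ T (0, y i)).det))
      Filter.atTop Filter.atTop := by
  subst hx0 hy0
  have hxpos := pos_of_backward_orbit_f hx₀ hxb
  have hypos := pos_of_backward_orbit_g hy₀ hyb
  obtain ⟨K, hK, hA⟩ := eventually_const_le_prod_mul_pow hx₀ hxb
  set A : ℕ → ℝ := fun n => ∏ i ∈ Finset.Icc 1 n, (fderiv ℝ T (x i, 0)).det with hAdef
  set B : ℕ → ℝ := fun n => ∏ i ∈ Finset.Icc 1 n, (fderiv ℝ T (0, y i)).det with hBdef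
  have hApos : ∀ n, 0 < A n := fun n =>
    Finset.prod_pos fun i _ => by rw [det_fderiv_T_left]; positivity
  have hBpos : ∀ n, 0 < B n := fun n =>
    Finset.prod_pos fun i _ => by rw [det_fderiv_T_right]; positivity
  have hB : ∀ n, B n ^ 4 * y n ^ 14 ≤ y 0 ^ 14 := prod_pow_mul_pow_le hy₀ hyb
  set c : ℝ := (1 + x 0 ^ 2)⁻¹ with hc
  have hcpos : 0 < c := by positivity
  have hC : 0 < K ^ 4 * c ^ 8 / (y 0 ^ 14 * 5 ^ 7) := by positivity
  have hlim : Filter.Tendsto (fun n : ℕ => K ^ 4 * c ^ 8 / (y 0 ^ 14 * 5 ^ 7) * (n : ℝ))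
      Filter.atTop Filter.atTop := tendsto_natCast_atTop_atTop.const_mul_atTop hC
  have hpow : Filter.Tendsto (fun n => (A n / B n) ^ 4) Filter.atTop Filter.atTop := by
    refine Filter.tendsto_atTop_mono' _ ?_ hlim
    obtain ⟨M, hM⟩ := exists_nat_ge (y 0 ^ 2)⁻¹
    filter_upwards [hA, Filter.eventually_ge_atTop M, Filter.eventually_ge_atTop 1]
      with n hAn hnM hn1
    have hxn := hxpos n
    have hyn := hypos n
    have hn : (0 : ℝ) < n := by exact_mod_cast hn1
    have hu : c * n ≤ (x n ^ 2)⁻¹ := linear_le_inv_sq_of_backward_orbit_f hx₀ hxb n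
    have hv : (y n ^ 2)⁻¹ ≤ 5 * n := by
      have h1 := inv_sq_le_linear_of_backward_orbit_g hy₀ hyb n
      have h2 : (M : ℝ) ≤ n := by exact_mod_cast hnM
      linarith
    have hA' : K * (c * n) ^ 2 ≤ A n := by
      calc K * (c * n) ^ 2 ≤ A n * x n ^ 4 * ((x n ^ 2)⁻¹) ^ 2 := by
            gcongr
            exact mul_nonneg (hApos n).le (by positivity)
        _ = A n := by field_simp
    have hB' : B n ^ 4 ≤ y 0 ^ 14 * (5 * n) ^ 7 := by
      calc B n ^ 4 = B n ^ 4 * y n ^ 14 * ((y n ^ 2)⁻¹) ^ 7 := by field_simp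
        _ ≤ y 0 ^ 14 * (5 * n) ^ 7 := by
            gcongr
            exact hB n
    calc K ^ 4 * c ^ 8 / (y 0 ^ 14 * 5 ^ 7) * (n : ℝ)
        = (K * (c * n) ^ 2) ^ 4 / (y 0 ^ 14 * (5 * n) ^ 7) := by field_simp
      _ ≤ A n ^ 4 / B n ^ 4 := by
          have := hBpos n
          gcongr
      _ = (A n / B n) ^ 4 := (div_pow _ _ _).symm
  refine Filter.tendsto_atTop.2 fun b => ?_
  filter_upwards [hpow.eventually_ge_atTop (b ^ 4)] with n hn
  by_contra! hlt
  exact absurd hn (not_le.2 (pow_lt_pow_left₀ hlt (div_pos (hApos n) (hBpos n)).le (by norm_num)))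
end

section
/- Let f(x) = x(1+x²), fix x₀ > 0, and let (x_n)_{n≥0} be the backward orbit determined by f(x_n) = x_{n−1} for n ≥ 1 (which exists and is unique since f is an increasing bijection of [0,∞)). Then there exist constants D₁, D₂ > 0 such that for all n ≥ 1, D₁·n^{5/2} ≤ ∏_{i=1}^{n} (1+3x_i²)(1+x_i²)² ≤ D₂·n^{5/2}. -/
section BackwardOrbit

variable {x : ℕ → ℝ}

theorem backwardOrbit_pos (h0 : 0 < x 0)
    (hx : ∀ n : ℕ, x (n + 1) * (1 + x (n + 1) ^ 2) = x n) (n : ℕ) : 0 < x n := by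
  induction n with
  | zero => exact h0
  | succ n ih =>
    rw [← hx n] at ih
    exact pos_of_mul_pos_left ih (by positivity)

theorem backwardOrbit_sq_le (hx : ∀ n : ℕ, x (n + 1) * (1 + x (n + 1) ^ 2) = x n) (n : ℕ) :
    x n ^ 2 ≤ x 0 ^ 2 := by
  induction n with
  | zero => exact le_rfl
  | succ n ih =>
    refine le_trans ?_ ih
    rw [← hx n, mul_pow]
    exact le_mul_of_one_le_right (sq_nonneg _) (one_le_pow₀ (by nlinarith [sq_nonneg (x (n + 1))]))

theorem backwardOrbit_inv_sq_succ_sub (h0 : 0 < x 0)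
    (hx : ∀ n : ℕ, x (n + 1) * (1 + x (n + 1) ^ 2) = x n) (n : ℕ) :
    (x (n + 1) ^ 2)⁻¹ - (x n ^ 2)⁻¹ = (2 + x (n + 1) ^ 2) / (1 + x (n + 1) ^ 2) ^ 2 := by
  have h := backwardOrbit_pos h0 hx (n + 1)
  have h1 : 1 + x (n + 1) ^ 2 ≠ 0 := by positivity
  rw [← hx n]
  field_simp
  ring

theorem backwardOrbit_inv_sq_le (h0 : 0 < x 0)
    (hx : ∀ n : ℕ, x (n + 1) * (1 + x (n + 1) ^ 2) = x n) (n : ℕ) :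
    (x n ^ 2)⁻¹ ≤ (x 0 ^ 2)⁻¹ + 2 * n := by
  induction n with
  | zero => simp
  | succ n ih =>
    have h := backwardOrbit_inv_sq_succ_sub h0 hx n
    have h2 : (2 + x (n + 1) ^ 2) / (1 + x (n + 1) ^ 2) ^ 2 ≤ 2 := by
      rw [div_le_iff₀ (by positivity)]
      nlinarith [sq_nonneg (x (n + 1)), sq_nonneg (x (n + 1) ^ 2)]
    push_cast
    linarith

theorem le_backwardOrbit_inv_sq (h0 : 0 < x 0)
    (hx : ∀ n : ℕ, x (n + 1) * (1 + x (n + 1) ^ 2) = x n) (n : ℕ) :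
    (1 + x 0 ^ 2)⁻¹ * n ≤ (x n ^ 2)⁻¹ := by
  induction n with
  | zero => simp [sq_nonneg]
  | succ n ih =>
    have h := backwardOrbit_inv_sq_succ_sub h0 hx n
    have h2 : (1 + x 0 ^ 2)⁻¹ ≤ (2 + x (n + 1) ^ 2) / (1 + x (n + 1) ^ 2) ^ 2 := by
      calc (1 + x 0 ^ 2)⁻¹ ≤ (1 + x (n + 1) ^ 2)⁻¹ := by
            exact inv_anti₀ (by positivity) (by linarith [backwardOrbit_sq_le hx (n + 1)])
        _ ≤ _ := by
            rw [le_div_iff₀ (by positivity), sq (1 + x (n + 1) ^ 2),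
              inv_mul_cancel_left₀ (by positivity)]
            linarith
    push_cast
    linarith

theorem prod_mul_backwardOrbit_pow_le (h0 : 0 < x 0)
    (hx : ∀ n : ℕ, x (n + 1) * (1 + x (n + 1) ^ 2) = x n) (n : ℕ) :
    (∏ i ∈ Finset.Icc 1 n, (1 + 3 * x i ^ 2) * (1 + x i ^ 2) ^ 2) * x n ^ 5 ≤ x 0 ^ 5 := by
  induction n with
  | zero => simp
  | succ n ih =>
    refine le_trans ?_ ih
    have h := backwardOrbit_pos h0 hx (n + 1)
    rw [Finset.prod_Icc_succ_top (by lia), mul_assoc]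
    refine mul_le_mul_of_nonneg_left ?_ (Finset.prod_nonneg fun i _ => by positivity)
    rw [← hx n]
    have h3 : 1 + 3 * x (n + 1) ^ 2 ≤ (1 + x (n + 1) ^ 2) ^ 3 := by
      have : 0 ≤ 3 * x (n + 1) ^ 4 + x (n + 1) ^ 6 := by positivity
      linarith
    calc _ ≤ (1 + x (n + 1) ^ 2) ^ 3 * (1 + x (n + 1) ^ 2) ^ 2 * x (n + 1) ^ 5 := by gcongr
      _ = _ := by ring

/-- The factor `exp (-(3/2) xₙ²)` absorbs the error in `1 + 3xₙ² ≈ (1 + xₙ²)³`. -/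
theorem le_prod_mul_backwardOrbit_pow_mul_exp (h0 : 0 < x 0)
    (hx : ∀ n : ℕ, x (n + 1) * (1 + x (n + 1) ^ 2) = x n) (n : ℕ) :
    x 0 ^ 5 * Real.exp (-(3 / 2 * x 0 ^ 2)) ≤
      (∏ i ∈ Finset.Icc 1 n, (1 + 3 * x i ^ 2) * (1 + x i ^ 2) ^ 2) *
        (x n ^ 5 * Real.exp (-(3 / 2 * x n ^ 2))) := by
  induction n with
  | zero => simp
  | succ n ih =>
    refine ih.trans ?_
    have h := backwardOrbit_pos h0 hx (n + 1)
    rw [Finset.prod_Icc_succ_top (by lia), mul_assoc]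
    refine mul_le_mul_of_nonneg_left ?_ (Finset.prod_nonneg fun i _ => by positivity)
    rw [← hx n]
    set y := x (n + 1)
    have hexp : (1 + y ^ 2) ^ 3 ≤
        (1 + 3 * y ^ 2) * Real.exp (3 / 2 * (2 * y ^ 4 + y ^ 6)) := by
      have h1 := Real.add_one_le_exp (3 / 2 * (2 * y ^ 4 + y ^ 6))
      calc (1 + y ^ 2) ^ 3 ≤ (1 + 3 * y ^ 2) * (3 / 2 * (2 * y ^ 4 + y ^ 6) + 1) := by
            have : 0 ≤ y ^ 6 / 2 + 9 * y ^ 6 + 9 / 2 * y ^ 8 := by positivity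
            linarith
        _ ≤ _ := by gcongr
    have hsplit : Real.exp (-(3 / 2 * y ^ 2)) =
        Real.exp (3 / 2 * (2 * y ^ 4 + y ^ 6)) *
          Real.exp (-(3 / 2 * (y * (1 + y ^ 2)) ^ 2)) := by
      rw [← Real.exp_add]
      ring_nf
    rw [hsplit]
    set E := Real.exp (-(3 / 2 * (y * (1 + y ^ 2)) ^ 2))
    calc (y * (1 + y ^ 2)) ^ 5 * E = (1 + y ^ 2) ^ 3 * ((1 + y ^ 2) ^ 2 * y ^ 5 * E) := by ring
      _ ≤ (1 + 3 * y ^ 2) * Real.exp (3 / 2 * (2 * y ^ 4 + y ^ 6)) *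
            ((1 + y ^ 2) ^ 2 * y ^ 5 * E) := by gcongr
      _ = _ := by ring

end BackwardOrbit

theorem inv_sq_rpow_five_halves {y : ℝ} (hy : 0 ≤ y) :
    ((y ^ 2)⁻¹) ^ ((5 : ℝ) / 2) = (y ^ 5)⁻¹ := by
  rw [Real.inv_rpow (sq_nonneg y), ← Real.rpow_natCast_mul hy, ← Real.rpow_natCast y 5]
  norm_num


/-- Example 1 of Hu–Vaienti, estimate along the invariant `x`-axis: for the
backward orbit of `x₀ > 0` under `f(x) = x(1+x²)`, the distortion products
`∏_{i=1}^n (1+3x_i²)(1+x_i²)² = |det DT^{-n}(x₀,0)|⁻¹` grow like `n^{5/2}`. -/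
theorem stmt_16 (x₀ : ℝ) (hx₀ : 0 < x₀) (x : ℕ → ℝ) (hx0 : x 0 = x₀)
    (hxb : ∀ n : ℕ, x (n + 1) * (1 + x (n + 1) ^ 2) = x n) :
    ∃ D₁ D₂ : ℝ, 0 < D₁ ∧ 0 < D₂ ∧ ∀ n : ℕ, 1 ≤ n →
      D₁ * (n : ℝ) ^ ((5 : ℝ) / 2) ≤
          ∏ i ∈ Finset.Icc 1 n, (1 + 3 * x i ^ 2) * (1 + x i ^ 2) ^ 2 ∧
        ∏ i ∈ Finset.Icc 1 n, (1 + 3 * x i ^ 2) * (1 + x i ^ 2) ^ 2 ≤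
          D₂ * (n : ℝ) ^ ((5 : ℝ) / 2) := by
  subst hx0
  have hb : 0 < (1 + x 0 ^ 2)⁻¹ := by positivity
  have hc : 0 < (x 0 ^ 2)⁻¹ + 2 := by positivity
  refine ⟨x 0 ^ 5 * Real.exp (-(3 / 2 * x 0 ^ 2)) * (1 + x 0 ^ 2)⁻¹ ^ ((5 : ℝ) / 2),
    x 0 ^ 5 * ((x 0 ^ 2)⁻¹ + 2) ^ ((5 : ℝ) / 2), by positivity, by positivity,
    fun n hn => ⟨?_, ?_⟩⟩
  all_goals have hxn := backwardOrbit_pos hx₀ hxb n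
  · have hle := le_prod_mul_backwardOrbit_pow_mul_exp hx₀ hxb n
    have hP : x 0 ^ 5 * Real.exp (-(3 / 2 * x 0 ^ 2)) ≤
        (∏ i ∈ Finset.Icc 1 n, (1 + 3 * x i ^ 2) * (1 + x i ^ 2) ^ 2) * x n ^ 5 := by
      refine hle.trans (mul_le_mul_of_nonneg_left ?_
        (Finset.prod_nonneg fun i _ => by positivity))
      exact mul_le_of_le_one_right (by positivity)
        (Real.exp_le_one_iff.mpr (by nlinarith [sq_nonneg (x n)]))
    rw [mul_assoc, ← Real.mul_rpow hb.le (Nat.cast_nonneg n)]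
    calc _ ≤ x 0 ^ 5 * Real.exp (-(3 / 2 * x 0 ^ 2)) * ((x n ^ 2)⁻¹) ^ ((5 : ℝ) / 2) := by
          gcongr
          exact le_backwardOrbit_inv_sq hx₀ hxb n
      _ ≤ _ := by
          rw [inv_sq_rpow_five_halves hxn.le]
          exact (mul_inv_le_iff₀ (by positivity)).mpr hP
  · have hn' : (1 : ℝ) ≤ n := by exact_mod_cast hn
    rw [mul_assoc, ← Real.mul_rpow hc.le (Nat.cast_nonneg n)]
    calc _ ≤ x 0 ^ 5 * ((x n ^ 2)⁻¹) ^ ((5 : ℝ) / 2) := by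
          rw [inv_sq_rpow_five_halves hxn.le]
          exact (le_mul_inv_iff₀ (by positivity)).mpr (prod_mul_backwardOrbit_pow_le hx₀ hxb n)
      _ ≤ _ := by
          gcongr
          refine (backwardOrbit_inv_sq_le hx₀ hxb n).trans ?_
          have : (x 0 ^ 2)⁻¹ ≤ (x 0 ^ 2)⁻¹ * n := le_mul_of_one_le_right (by positivity) hn'
          linarith
end
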